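/- arXiv:math/0311486 — 2 statements merged into one kernel-verified Lean document; each statement's English description precedes it below -/
import Mathlib

section
/- Generators of the Δ-side length cone for A₂: Let C ⊂ ℝ³ × ℝ³ × ℝ³ be the set of all triples (λ(A), λ(B), λ(C)) where A, B, C range over traceless Hermitian 3×3 complex matrices with A + B + C = 0, and λ(M) ∈ ℝ³ denotes the eigenvalues of M listed in decreasing order. Then C equals the set of all linear combinations with non-negative real coefficients of the following eight triples: ((2,−1,−1),(2,−1,−1),(2,−1,−1)); ((1,1,−2),(2,−1,−1),(0,0,0)); ((0,0,0),(1,1,−2),(2,−1,−1)); ((2,−1,−1),(0,0,0),(1,1,−2)); ((0,0,0),(2,−1,−1),(1,1,−2)); ((2,−1,−1),(1,1,−2),(0,0,0)); ((1,1,−2),(0,0,0),(2,−1,−1)); ((1,1,−2),(1,1,−2),(1,1,−2)). -/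
open Matrix

/-- The `Δ`-side length cone for `A₂`: the set of triples of decreasingly
ordered spectra of traceless Hermitian `3×3` matrices `A`, `B`, `C` with
`A + B + C = 0`. -/
def A2SideLengthCone : Set ((Fin 3 → ℝ) × (Fin 3 → ℝ) × (Fin 3 → ℝ)) :=
  { t | Antitone t.1 ∧ Antitone t.2.1 ∧ Antitone t.2.2 ∧
    ∃ A B C : Matrix (Fin 3) (Fin 3) ℂ,
      A.trace = 0 ∧ B.trace = 0 ∧ C.trace = 0 ∧ A + B + C = 0 ∧
      (∃ hA : A.IsHermitian, ∃ σ : Equiv.Perm (Fin 3),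
        ∀ j, hA.eigenvalues (σ j) = t.1 j) ∧
      (∃ hB : B.IsHermitian, ∃ σ : Equiv.Perm (Fin 3),
        ∀ j, hB.eigenvalues (σ j) = t.2.1 j) ∧
      (∃ hC : C.IsHermitian, ∃ σ : Equiv.Perm (Fin 3),
        ∀ j, hC.eigenvalues (σ j) = t.2.2 j) }

/-- The eight generators of the `Δ`-side length cone `𝒫₃(A₂)`. -/
noncomputable def A2Generators : Fin 8 → (Fin 3 → ℝ) × (Fin 3 → ℝ) × (Fin 3 → ℝ) :=
  ![(![2, -1, -1], ![2, -1, -1], ![2, -1, -1]),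
    (![1, 1, -2], ![2, -1, -1], ![0, 0, 0]),
    (![0, 0, 0], ![1, 1, -2], ![2, -1, -1]),
    (![2, -1, -1], ![0, 0, 0], ![1, 1, -2]),
    (![0, 0, 0], ![2, -1, -1], ![1, 1, -2]),
    (![2, -1, -1], ![1, 1, -2], ![0, 0, 0]),
    (![1, 1, -2], ![0, 0, 0], ![2, -1, -1]),
    (![1, 1, -2], ![1, 1, -2], ![1, 1, -2])]

/-- In the rectangle `[c, b + c] × [d, a + d]`, some point of the hyperbola `X * Y = M` takes the
value `R` under the linear form `(b + c) * c * Y - (a + d) * d * X`, provided `M` and `R` satisfy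
the evident bounds on the boundary. -/
theorem exists_mul_eq_of_line {a b c d M R : ℝ} (ha : 0 ≤ a) (hb : 0 ≤ b) (hc : 0 ≤ c)
    (hd : 0 ≤ d) (hM₀ : c * d ≤ M) (hM₁ : M ≤ (b + c) * (a + d))
    (h₁ : c * M - (b + c) * ((a + d) * d) ≤ R) (h₂ : R ≤ (b + c) * M - c * ((a + d) * d))
    (h₃ : R ≤ (a + d) * ((b + c) * c) - d * M) (h₄ : d * ((b + c) * c) - (a + d) * M ≤ R) :
    ∃ X Y : ℝ, c ≤ X ∧ X ≤ b + c ∧ d ≤ Y ∧ Y ≤ a + d ∧ X * Y = M ∧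
      (b + c) * c * Y - (a + d) * d * X = R := by
  obtain ⟨P, hP⟩ : ∃ P, P = (b + c) * c := ⟨_, rfl⟩
  obtain ⟨Q, hQ⟩ : ∃ Q, Q = (a + d) * d := ⟨_, rfl⟩
  rw [← hP, ← hQ]
  rw [← hQ] at h₁ h₂
  rw [← hP] at h₃ h₄
  have hP0 : 0 ≤ P := by rw [hP]; positivity
  have hQ0 : 0 ≤ Q := by rw [hQ]; positivity
  have hTL : R ≤ P * (a + d) - Q * c := by
    rcases le_total M (c * (a + d)) with h | h
    · have := mul_le_mul_of_nonneg_left h (add_nonneg hb hc)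
      rw [hP]; linarith
    · have := mul_le_mul_of_nonneg_left h hd
      rw [hQ]; linarith
  have hBR : P * d - Q * (b + c) ≤ R := by
    rcases le_total M (d * (b + c)) with h | h
    · have := mul_le_mul_of_nonneg_left h (add_nonneg ha hd)
      rw [hQ]; linarith
    · have := mul_le_mul_of_nonneg_left h hc
      rw [hP]; linarith
  -- a point with small product
  obtain ⟨X₀, Y₀, hX₀, hX₀', hY₀, hY₀', hl₀, hm₀⟩ : ∃ X Y : ℝ, c ≤ X ∧ X ≤ b + c ∧ d ≤ Y ∧
      Y ≤ a + d ∧ P * Y - Q * X = R ∧ X * Y ≤ M := by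
    rcases lt_trichotomy R (P * d - Q * c) with h | h | h
    · have hq : 0 < Q := by
        rcases hQ0.eq_or_lt with h0 | h0
        · rw [← h0] at h hBR; linarith
        · exact h0
      have had : 0 < a + d := by
        rcases (add_nonneg ha hd).eq_or_lt with h0 | h0
        · rw [hQ, ← h0] at hq; linarith
        · exact h0
      have hX : Q * ((P * d - R) / Q) = P * d - R := by field_simp
      refine ⟨(P * d - R) / Q, d, ?_, ?_, le_rfl, by linarith, by linarith, ?_⟩
      · rw [le_div_iff₀ hq]; linarith
      · rw [div_le_iff₀ hq]; linarith
      · rw [div_mul_eq_mul_div, div_le_iff₀ hq, hQ]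
        nlinarith
    · exact ⟨c, d, le_rfl, by linarith, le_rfl, by linarith, h.symm, hM₀⟩
    · have hp : 0 < P := by
        rcases hP0.eq_or_lt with h0 | h0
        · rw [← h0] at h hTL; linarith
        · exact h0
      have hX : P * ((R + Q * c) / P) = R + Q * c := by field_simp
      refine ⟨c, (R + Q * c) / P, le_rfl, by linarith, ?_, ?_, by linarith, ?_⟩
      · rw [le_div_iff₀ hp]; linarith
      · rw [div_le_iff₀ hp]; linarith
      · rw [mul_div_assoc', div_le_iff₀ hp, hP]
        nlinarith
  -- a point with large product
  obtain ⟨X₁, Y₁, hX₁, hX₁', hY₁, hY₁', hl₁, hm₁⟩ : ∃ X Y : ℝ, c ≤ X ∧ X ≤ b + c ∧ d ≤ Y ∧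
      Y ≤ a + d ∧ P * Y - Q * X = R ∧ M ≤ X * Y := by
    rcases lt_trichotomy R (P * (a + d) - Q * (b + c)) with h | h | h
    · have hp : 0 < P := by
        rcases hP0.eq_or_lt with h0 | h0
        · rw [← h0] at h hBR; linarith
        · exact h0
      have hX : P * ((R + Q * (b + c)) / P) = R + Q * (b + c) := by field_simp
      refine ⟨b + c, (R + Q * (b + c)) / P, by linarith, le_rfl, ?_, ?_, by linarith, ?_⟩
      · rw [le_div_iff₀ hp]; linarith
      · rw [div_le_iff₀ hp]; linarith
      · rw [mul_div_assoc', le_div_iff₀ hp, hP]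
        nlinarith
    · exact ⟨b + c, a + d, by linarith, le_rfl, by linarith, le_rfl, h.symm, hM₁⟩
    · have hq : 0 < Q := by
        rcases hQ0.eq_or_lt with h0 | h0
        · rw [← h0] at h hTL; linarith
        · exact h0
      have hX : Q * ((P * (a + d) - R) / Q) = P * (a + d) - R := by field_simp
      refine ⟨(P * (a + d) - R) / Q, a + d, ?_, ?_, by linarith, le_rfl, by linarith, ?_⟩
      · rw [le_div_iff₀ hq]; linarith
      · rw [div_le_iff₀ hq]; linarith
      · rw [div_mul_eq_mul_div, le_div_iff₀ hq, hQ]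
        nlinarith
  have hcont : Continuous fun θ : ℝ =>
      ((1 - θ) * X₀ + θ * X₁) * ((1 - θ) * Y₀ + θ * Y₁) := by fun_prop
  obtain ⟨θ, ⟨hθ₀, hθ₁⟩, hθ⟩ := intermediate_value_Icc (zero_le_one' ℝ) hcont.continuousOn
    (show M ∈ Set.Icc _ _ from ⟨by simpa using hm₀, by simpa using hm₁⟩)
  have hθ₂ : 0 ≤ 1 - θ := by linarith
  refine ⟨(1 - θ) * X₀ + θ * X₁, (1 - θ) * Y₀ + θ * Y₁, ?_, ?_, ?_, ?_, hθ, ?_⟩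
  · nlinarith
  · nlinarith
  · nlinarith
  · nlinarith
  · linear_combination (1 - θ) * hl₀ + θ * hl₁

/-- The trace conditions and Horn inequalities for ordered spectra `α`, `β`, `γ` of Hermitian
`3×3` matrices with sum zero. -/
structure IsA2Horn (α β γ : Fin 3 → ℝ) : Prop where
  anti₁ : Antitone α
  anti₂ : Antitone β
  anti₃ : Antitone γ
  sum₁ : α 0 + α 1 + α 2 = 0
  sum₂ : β 0 + β 1 + β 2 = 0
  sum₃ : γ 0 + γ 1 + γ 2 = 0
  nonneg_002 : 0 ≤ α 0 + β 0 + γ 2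
  nonneg_020 : 0 ≤ α 0 + β 2 + γ 0
  nonneg_200 : 0 ≤ α 2 + β 0 + γ 0
  nonneg_011 : 0 ≤ α 0 + β 1 + γ 1
  nonneg_101 : 0 ≤ α 1 + β 0 + γ 1
  nonneg_110 : 0 ≤ α 1 + β 1 + γ 0
  nonpos_022 : α 0 + β 2 + γ 2 ≤ 0
  nonpos_202 : α 2 + β 0 + γ 2 ≤ 0
  nonpos_220 : α 2 + β 2 + γ 0 ≤ 0
  nonpos_112 : α 1 + β 1 + γ 2 ≤ 0
  nonpos_121 : α 1 + β 2 + γ 1 ≤ 0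
  nonpos_211 : α 2 + β 1 + γ 1 ≤ 0

theorem antitone_fin_three {f : Fin 3 → ℝ} : Antitone f ↔ f 1 ≤ f 0 ∧ f 2 ≤ f 1 := by
  rw [Fin.antitone_iff_succ_le]
  simp [Fin.forall_fin_two]

theorem IsA2Horn.rotate {α β γ : Fin 3 → ℝ} (h : IsA2Horn α β γ) : IsA2Horn β γ α := by
  obtain ⟨_, _, _, _, _, _, _, _, _, _, _, _, _, _, _, _, _, _⟩ := h
  constructor <;> first | assumption | linarith

theorem exists_min_three (a b c : ℝ) : ∃ m, m ≤ a ∧ m ≤ b ∧ m ≤ c ∧ (m = a ∨ m = b ∨ m = c) := by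
  rcases le_total a b with h | h <;> rcases le_total b c with h' | h' <;>
    rcases le_total a c with h'' | h''
  all_goals first
    | exact ⟨a, by linarith, by linarith, by linarith, by simp⟩
    | exact ⟨b, by linarith, by linarith, by linarith, by simp⟩
    | exact ⟨c, by linarith, by linarith, by linarith, by simp⟩

theorem isA2Horn_iff_exists_sum_smul_A2Generators
    {t : (Fin 3 → ℝ) × (Fin 3 → ℝ) × (Fin 3 → ℝ)} :
    IsA2Horn t.1 t.2.1 t.2.2 ↔
      ∃ c : Fin 8 → ℝ, (∀ k, 0 ≤ c k) ∧ t = ∑ k, c k • A2Generators k := by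
  unfold A2Generators
  obtain ⟨α, β, γ⟩ := t
  simp only [Prod.ext_iff, funext_iff, Fin.sum_univ_eight, Prod.fst_add, Prod.snd_add, Prod.smul_fst,
    Prod.smul_snd, Pi.add_apply, Pi.smul_apply, smul_eq_mul, Fin.forall_fin_succ, Matrix.cons_val]
  constructor
  · rintro ⟨ha, hb, hc, _, _, _, _, _, _, _, _, _, _, _, _, _, _, _⟩
    rw [antitone_fin_three] at ha hb hc
    -- differences of the coefficients within the two three-cycles
    obtain ⟨m, hm₁, hm₂, hm₃, hm⟩ := exists_min_three 0
      ((α 1 - α 2 - (β 0 - β 1) - (α 1 + β 1 + γ 1)) / 3)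
      ((α 0 - α 1 - (γ 1 - γ 2) + (α 1 + β 1 + γ 1)) / 3)
    obtain ⟨n, hn₁, hn₂, hn₃, hn⟩ := exists_min_three 0
      ((γ 0 - γ 1 - (α 1 - α 2) + (α 1 + β 1 + γ 1)) / 3)
      ((γ 1 - γ 2 - (β 0 - β 1) - (α 1 + β 1 + γ 1)) / 3)
    refine ⟨![(α 0 - α 1) / 3 - ((α 0 - α 1 - (γ 1 - γ 2) + (α 1 + β 1 + γ 1)) / 3 - m)
        - ((γ 1 - γ 2 - (β 0 - β 1) - (α 1 + β 1 + γ 1)) / 3 - n),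
      -n, (γ 0 - γ 1 - (α 1 - α 2) + (α 1 + β 1 + γ 1)) / 3 - n,
      (γ 1 - γ 2 - (β 0 - β 1) - (α 1 + β 1 + γ 1)) / 3 - n,
      -m, (α 0 - α 1 - (γ 1 - γ 2) + (α 1 + β 1 + γ 1)) / 3 - m,
      (α 1 - α 2 - (β 0 - β 1) - (α 1 + β 1 + γ 1)) / 3 - m,
      (α 1 - α 2) / 3 - ((α 1 - α 2 - (β 0 - β 1) - (α 1 + β 1 + γ 1)) / 3 - m) + n], ?_, ?_⟩
    · simp
      refine ⟨?_, ?_, ?_, ?_, ?_, ?_, ?_, ?_⟩ <;>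
      rcases hm with rfl | rfl | rfl <;> rcases hn with rfl | rfl | rfl <;> linarith
    · simp
      refine ⟨⟨?_, ?_, ?_⟩, ⟨?_, ?_, ?_⟩, ?_, ?_, ?_⟩ <;> linarith
  · rintro ⟨c, ⟨h0, h1, h2, h3, h4, h5, h6, h7⟩, h⟩
    simp at *
    obtain ⟨⟨a0, a1, a2⟩, ⟨b0, b1, b2⟩, c0, c1, c2⟩ := h
    constructor <;> (try rw [antitone_fin_three]) <;> (try constructor) <;> linarith

theorem exists_perm_of_map_univ_eq {ι β : Type*} [Fintype ι] {f g : ι → β}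
    (h : Finset.univ.val.map f = Finset.univ.val.map g) :
    ∃ σ : Equiv.Perm ι, ∀ i, f (σ i) = g i := by
  classical
  have hcard (b : β) : Nonempty ({i // g i = b} ≃ {i // f i = b}) := by
    rw [← Fintype.card_eq, Fintype.card_subtype, Fintype.card_subtype]
    have := congrArg (Multiset.count b) h
    simp only [Multiset.count_map, eq_comm (a := b)] at this
    exact this.symm
  refine ⟨Equiv.ofFiberEquiv fun b => (hcard b).some, fun i => Equiv.ofFiberEquiv_map _ i⟩

theorem exists_perm_eigenvalues_of_charpoly_eq {n : Type*} [Fintype n] [DecidableEq n]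
    {A : Matrix n n ℂ} (hA : A.IsHermitian) {t : n → ℝ}
    (h : A.charpoly = ∏ i, (Polynomial.X - Polynomial.C (t i : ℂ))) :
    ∃ σ : Equiv.Perm n, ∀ j, hA.eigenvalues (σ j) = t j := by
  apply exists_perm_of_map_univ_eq
  have h₁ := hA.roots_charpoly_eq_eigenvalues
  rw [h, Polynomial.roots_prod _ _ (by simp [Finset.prod_ne_zero_iff, Polynomial.X_sub_C_ne_zero])]
    at h₁
  apply Multiset.map_injective Complex.ofReal_injective
  rw [Multiset.map_map, Multiset.map_map]
  simpa [Function.comp_def] using h₁.symm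

/-- The real symmetric tridiagonal matrix with diagonal `p, q, r` and off-diagonal `u, v`, with
complex entries. -/
def tridiagonal (p q r u v : ℝ) : Matrix (Fin 3) (Fin 3) ℂ :=
  !![(p : ℂ), u, 0; (u : ℂ), q, v; 0, (v : ℂ), r]

theorem tridiagonal_isHermitian (p q r u v : ℝ) : (tridiagonal p q r u v).IsHermitian := by
  ext i j
  fin_cases i <;> fin_cases j <;> simp [tridiagonal]

theorem trace_tridiagonal (p q r u v : ℝ) :
    (tridiagonal p q r u v).trace = ((p + q + r : ℝ) : ℂ) := by
  simp [tridiagonal, trace_fin_three]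

theorem exists_perm_eigenvalues_tridiagonal {p q r u v : ℝ} {t : Fin 3 → ℝ}
    (h₁ : p + q + r = t 0 + t 1 + t 2)
    (h₂ : p * q + p * r + q * r - u ^ 2 - v ^ 2 = t 0 * t 1 + t 0 * t 2 + t 1 * t 2)
    (h₃ : p * q * r - u ^ 2 * r - v ^ 2 * p = t 0 * t 1 * t 2) :
    ∃ hA : (tridiagonal p q r u v).IsHermitian, ∃ σ : Equiv.Perm (Fin 3),
      ∀ j, hA.eigenvalues (σ j) = t j := by
  refine ⟨tridiagonal_isHermitian p q r u v, exists_perm_eigenvalues_of_charpoly_eq _ ?_⟩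
  have e₁ := congrArg (fun x : ℝ => Polynomial.C (x : ℂ)) h₁
  have e₂ := congrArg (fun x : ℝ => Polynomial.C (x : ℂ)) h₂
  have e₃ := congrArg (fun x : ℝ => Polynomial.C (x : ℂ)) h₃
  simp only [Complex.ofReal_add, Complex.ofReal_mul, Complex.ofReal_sub, Complex.ofReal_pow,
    Polynomial.C_add, Polynomial.C_mul, Polynomial.C_sub, Polynomial.C_pow] at e₁ e₂ e₃
  rw [Matrix.charpoly, Matrix.det_fin_three, Fin.prod_univ_three]
  simp [tridiagonal]
  linear_combination (-Polynomial.X ^ 2) * e₁ + Polynomial.X * e₂ - e₃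

/-- A Hermitian matrix is unitarily diagonalized by any enumeration of its eigenvalues. -/
theorem exists_unitary_diagonalization {n : Type*} [Fintype n] [DecidableEq n]
    {A : Matrix n n ℂ} (hA : A.IsHermitian) {t : n → ℝ} {σ : Equiv.Perm n}
    (h : ∀ j, hA.eigenvalues (σ j) = t j) :
    ∃ W : Matrix n n ℂ, Wᴴ * W = 1 ∧ A = Wᴴ * diagonal (fun i => (t i : ℂ)) * W := by
  refine ⟨(hA.eigenvectorUnitary : Matrix n n ℂ)ᴴ.submatrix σ id, ?_, ?_⟩
  · rw [conjTranspose_submatrix, submatrix_mul_equiv, conjTranspose_conjTranspose]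
    have := hA.eigenvectorUnitary.2
    rw [mem_unitaryGroup_iff, star_eq_conjTranspose] at this
    rw [this, submatrix_id_id]
  · have hd : diagonal (fun i => (t i : ℂ)) =
        (diagonal (RCLike.ofReal ∘ hA.eigenvalues) : Matrix n n ℂ).submatrix σ σ := by
      rw [submatrix_diagonal_equiv]
      congr 1
      funext i
      simp [← h]
    rw [hd, conjTranspose_submatrix, submatrix_mul_equiv, submatrix_mul_equiv,
      conjTranspose_conjTranspose, submatrix_id_id]
    have := hA.spectral_theorem
    rw [Unitary.conjStarAlgAut_apply] at this
    exact this

theorem sum_eq_zero_of_trace_eq_zero {A : Matrix (Fin 3) (Fin 3) ℂ} (hA : A.IsHermitian)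
    (h₀ : A.trace = 0) {t : Fin 3 → ℝ} {σ : Equiv.Perm (Fin 3)}
    (h : ∀ j, hA.eigenvalues (σ j) = t j) : t 0 + t 1 + t 2 = 0 := by
  rw [hA.trace_eq_sum_eigenvalues, ← Equiv.sum_comp σ] at h₀
  simp only [h, Fin.sum_univ_three] at h₀
  exact Complex.ofReal_injective (by simpa using h₀)

theorem star_dotProduct_conj_mulVec {n : Type*} [Fintype n] [DecidableEq n] (W : Matrix n n ℂ)
    (d : n → ℝ) (u : n → ℂ) :
    star u ⬝ᵥ ((Wᴴ * diagonal (fun i => (d i : ℂ)) * W) *ᵥ u) =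
      ((∑ i, d i * Complex.normSq ((W *ᵥ u) i) : ℝ) : ℂ) := by
  rw [← mulVec_mulVec, ← mulVec_mulVec, dotProduct_mulVec, ← star_mulVec]
  simp [dotProduct, mulVec_diagonal, Complex.normSq_eq_conj_mul_self]
  refine Finset.sum_congr rfl fun i _ => by ring

theorem exists_ne_zero_mulVec_eq_zero (V W : Matrix (Fin 3) (Fin 3) ℂ) (i j : Fin 3) :
    ∃ u : Fin 3 → ℂ, u ≠ 0 ∧ (V *ᵥ u) i = 0 ∧ (W *ᵥ u) j = 0 := by
  obtain ⟨u, hu, h⟩ := Matrix.exists_mulVec_eq_zero_iff.mpr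
    (det_eq_zero_of_row_eq_zero (A := of ![V i, W j, 0]) 2 fun _ => rfl)
  exact ⟨u, hu, congrFun h 0, congrFun h 1⟩

theorem sum_normSq_mulVec_of_conjTranspose_mul_self {n : Type*} [Fintype n] [DecidableEq n]
    {W : Matrix n n ℂ} (hW : Wᴴ * W = 1) (u : n → ℂ) :
    ∑ i, Complex.normSq ((W *ᵥ u) i) = ∑ i, Complex.normSq (u i) := by
  have h₁ := star_dotProduct_conj_mulVec W (fun _ => 1) u
  have h₂ := star_dotProduct_conj_mulVec (1 : Matrix n n ℂ) (fun _ => 1) u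
  simp only [Complex.ofReal_one, diagonal_one, mul_one, hW, conjTranspose_one, one_mul,
    one_mulVec] at h₁ h₂
  exact_mod_cast h₁.symm.trans h₂

theorem horn_inequalities {W₁ W₂ W₃ : Matrix (Fin 3) (Fin 3) ℂ} {α β γ : Fin 3 → ℝ}
    (hα : Antitone α) (hβ : Antitone β) (hγ : Antitone γ)
    (h₁ : W₁ᴴ * W₁ = 1) (h₂ : W₂ᴴ * W₂ = 1) (h₃ : W₃ᴴ * W₃ = 1)
    (h : W₁ᴴ * diagonal (fun i => (α i : ℂ)) * W₁ + W₂ᴴ * diagonal (fun i => (β i : ℂ)) * W₂ +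
      W₃ᴴ * diagonal (fun i => (γ i : ℂ)) * W₃ = 0) :
    0 ≤ α 0 + β 0 + γ 2 ∧ 0 ≤ α 0 + β 1 + γ 1 ∧ α 0 + β 2 + γ 2 ≤ 0 ∧ α 1 + β 1 + γ 2 ≤ 0 := by
  rw [antitone_fin_three] at hα hβ hγ
  have key (u : Fin 3 → ℂ) (hu : u ≠ 0) : ∃ p q r : Fin 3 → ℝ,
      p = (fun i => Complex.normSq ((W₁ *ᵥ u) i)) ∧ q = (fun i => Complex.normSq ((W₂ *ᵥ u) i)) ∧
      r = (fun i => Complex.normSq ((W₃ *ᵥ u) i)) ∧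
      (∀ i, 0 ≤ p i) ∧ (∀ i, 0 ≤ q i) ∧ (∀ i, 0 ≤ r i) ∧ 0 < p 0 + p 1 + p 2 ∧
      q 0 + q 1 + q 2 = p 0 + p 1 + p 2 ∧ r 0 + r 1 + r 2 = p 0 + p 1 + p 2 ∧
      α 0 * p 0 + α 1 * p 1 + α 2 * p 2 + (β 0 * q 0 + β 1 * q 1 + β 2 * q 2) +
        (γ 0 * r 0 + γ 1 * r 1 + γ 2 * r 2) = 0 := by
    refine ⟨_, _, _, rfl, rfl, rfl, fun _ => Complex.normSq_nonneg _,
      fun _ => Complex.normSq_nonneg _, fun _ => Complex.normSq_nonneg _, ?_⟩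
    simp only [← Fin.sum_univ_three (fun i => Complex.normSq ((W₁ *ᵥ u) i)),
      ← Fin.sum_univ_three (fun i => Complex.normSq ((W₂ *ᵥ u) i)),
      ← Fin.sum_univ_three (fun i => Complex.normSq ((W₃ *ᵥ u) i)),
      sum_normSq_mulVec_of_conjTranspose_mul_self h₁,
      sum_normSq_mulVec_of_conjTranspose_mul_self h₂,
      sum_normSq_mulVec_of_conjTranspose_mul_self h₃, true_and]
    constructor
    · obtain ⟨i, hi⟩ := Function.ne_iff.mp hu
      exact Finset.sum_pos' (fun _ _ => Complex.normSq_nonneg _)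
        ⟨i, Finset.mem_univ i, Complex.normSq_pos.mpr hi⟩
    · have := congrArg (fun A => star u ⬝ᵥ (A *ᵥ u)) h
      simp only [add_mulVec, dotProduct_add, star_dotProduct_conj_mulVec, zero_mulVec,
        dotProduct_zero, Fin.sum_univ_three] at this
      exact_mod_cast this
  refine ⟨?_, ?_, ?_, ?_⟩
  · obtain ⟨u, hu, e₁, e₂⟩ := exists_ne_zero_mulVec_eq_zero W₃ W₃ 0 1
    obtain ⟨p, q, r, hp, hq, hr, p0, q0, r0, hpos, hq', hr', hsum⟩ := key u hu
    have z₁ : r 0 = 0 := by simp [hr, e₁]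
    have z₂ : r 1 = 0 := by simp [hr, e₂]
    refine nonneg_of_mul_nonneg_left ?_ hpos
    have i₁ := congrArg (β 0 * ·) hq'
    have i₂ := congrArg (γ 2 * ·) hr'
    simp only [z₁, z₂] at i₁ i₂ hsum ⊢
    linarith [mul_nonneg (p0 1) (sub_nonneg.2 hα.1), mul_nonneg (p0 2) (sub_nonneg.2 hα.1),
      mul_nonneg (p0 2) (sub_nonneg.2 hα.2), mul_nonneg (q0 1) (sub_nonneg.2 hβ.1),
      mul_nonneg (q0 2) (sub_nonneg.2 hβ.1), mul_nonneg (q0 2) (sub_nonneg.2 hβ.2)]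
  · obtain ⟨u, hu, e₁, e₂⟩ := exists_ne_zero_mulVec_eq_zero W₂ W₃ 0 0
    obtain ⟨p, q, r, hp, hq, hr, p0, q0, r0, hpos, hq', hr', hsum⟩ := key u hu
    have z₁ : q 0 = 0 := by simp [hq, e₁]
    have z₂ : r 0 = 0 := by simp [hr, e₂]
    refine nonneg_of_mul_nonneg_left ?_ hpos
    have i₁ := congrArg (β 1 * ·) hq'
    have i₂ := congrArg (γ 1 * ·) hr'
    simp only [z₁, z₂] at i₁ i₂ hsum ⊢
    linarith [mul_nonneg (p0 1) (sub_nonneg.2 hα.1), mul_nonneg (p0 2) (sub_nonneg.2 hα.1),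
      mul_nonneg (p0 2) (sub_nonneg.2 hα.2), mul_nonneg (q0 2) (sub_nonneg.2 hβ.2),
      mul_nonneg (r0 2) (sub_nonneg.2 hγ.2)]
  · obtain ⟨u, hu, e₁, e₂⟩ := exists_ne_zero_mulVec_eq_zero W₁ W₁ 1 2
    obtain ⟨p, q, r, hp, hq, hr, p0, q0, r0, hpos, hq', hr', hsum⟩ := key u hu
    have z₁ : p 1 = 0 := by simp [hp, e₁]
    have z₂ : p 2 = 0 := by simp [hp, e₂]
    refine nonpos_of_mul_nonpos_left ?_ hpos
    have i₁ := congrArg (β 2 * ·) hq'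
    have i₂ := congrArg (γ 2 * ·) hr'
    simp only [z₁, z₂] at i₁ i₂ hsum ⊢
    linarith [mul_nonneg (q0 1) (sub_nonneg.2 hβ.2), mul_nonneg (q0 0) (sub_nonneg.2 hβ.1),
      mul_nonneg (q0 0) (sub_nonneg.2 hβ.2), mul_nonneg (r0 1) (sub_nonneg.2 hγ.2),
      mul_nonneg (r0 0) (sub_nonneg.2 hγ.1), mul_nonneg (r0 0) (sub_nonneg.2 hγ.2)]
  · obtain ⟨u, hu, e₁, e₂⟩ := exists_ne_zero_mulVec_eq_zero W₁ W₂ 2 2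
    obtain ⟨p, q, r, hp, hq, hr, p0, q0, r0, hpos, hq', hr', hsum⟩ := key u hu
    have z₁ : p 2 = 0 := by simp [hp, e₁]
    have z₂ : q 2 = 0 := by simp [hq, e₂]
    refine nonpos_of_mul_nonpos_left ?_ hpos
    have i₁ := congrArg (β 1 * ·) hq'
    have i₂ := congrArg (γ 2 * ·) hr'
    simp only [z₁, z₂] at i₁ i₂ hsum ⊢
    linarith [mul_nonneg (p0 0) (sub_nonneg.2 hα.1), mul_nonneg (q0 0) (sub_nonneg.2 hβ.1),
      mul_nonneg (r0 1) (sub_nonneg.2 hγ.2), mul_nonneg (r0 0) (sub_nonneg.2 hγ.1),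
      mul_nonneg (r0 0) (sub_nonneg.2 hγ.2)]

theorem IsA2Horn.exists_parameters {α β γ : Fin 3 → ℝ} (h : IsA2Horn α β γ)
    (hu : 0 ≤ α 2 + β 1 + γ 0) (hv : α 1 + β 0 + γ 2 ≤ 0) :
    ∃ X Y : ℝ, β 0 - β 1 ≤ X ∧ X ≤ β 0 - β 2 ∧ α 1 - α 2 ≤ Y ∧ Y ≤ α 0 - α 2 ∧
      X * Y = (β 1 - β 2) * (α 0 + α 1 - 2 * α 2 + (β 0 - β 1)) +
        ((γ 2 + α 2 + β 1) * (γ 1 + α 2 + β 1) + (γ 2 + α 2 + β 1) * (γ 0 + α 2 + β 1) +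
          (γ 1 + α 2 + β 1) * (γ 0 + α 2 + β 1)) - (α 0 - α 2) * (α 1 - α 2) ∧
      (β 0 - β 2) * (β 0 - β 1) * Y - (α 0 - α 2) * (α 1 - α 2) * X =
        (γ 2 + α 2 + β 1) * (γ 1 + α 2 + β 1) * (γ 0 + α 2 + β 1) +
        (β 0 - β 1) * (X * Y) - (β 0 - β 2) * ((α 0 - α 2) * (α 1 - α 2)) := by
  obtain ⟨ha, hb, hc, hs₁, hs₂, hs₃, k002, k020, k200, k011, k101, k110, k022, k202, k220, k112,
    k121, k211⟩ := h
  rw [antitone_fin_three] at ha hb hc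
  obtain ⟨M, hM⟩ : ∃ M, M = (β 1 - β 2) * (α 0 + α 1 - 2 * α 2 + (β 0 - β 1)) +
        ((γ 2 + α 2 + β 1) * (γ 1 + α 2 + β 1) + (γ 2 + α 2 + β 1) * (γ 0 + α 2 + β 1) +
          (γ 1 + α 2 + β 1) * (γ 0 + α 2 + β 1)) - (α 0 - α 2) * (α 1 - α 2) := ⟨_, rfl⟩
  obtain ⟨R, hR⟩ : ∃ R, R = (γ 2 + α 2 + β 1) * (γ 1 + α 2 + β 1) * (γ 0 + α 2 + β 1) +
        (β 0 - β 1) * M - (β 0 - β 2) * ((α 0 - α 2) * (α 1 - α 2)) := ⟨_, rfl⟩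
  have eα : α 0 = - α 1 - α 2 := by linarith
  have eβ : β 0 = - β 1 - β 2 := by linarith
  have eγ : γ 0 = - γ 1 - γ 2 := by linarith
  have n₁ : 0 ≤ (γ 2 + α 2 + β 1) * (γ 1 + α 2 + β 1) * (γ 0 + α 2 + β 1) :=
    mul_nonneg (mul_nonneg_of_nonpos_of_nonpos (by linarith) (by linarith)) (by linarith)
  have n₂ : 0 ≤ -(α 2 + β 2 + γ 0) * (-(α 2 + β 2 + γ 1) * -(α 2 + β 2 + γ 2)) :=
    mul_nonneg (by linarith) (mul_nonneg (by linarith) (by linarith))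
  have n₃ : 0 ≤ (α 1 + β 0 + γ 0) * (α 1 + β 0 + γ 1) * -(α 1 + β 0 + γ 2) :=
    mul_nonneg (mul_nonneg (by linarith) (by linarith)) (by linarith)
  have n₄ : 0 ≤ (α 0 + β 0 + γ 0) * (α 0 + β 0 + γ 1) * (α 0 + β 0 + γ 2) :=
    mul_nonneg (mul_nonneg (by linarith) (by linarith)) (by linarith)
  have h₁ : (β 0 - β 1) * M - (β 0 - β 2) * ((α 0 - α 2) * (α 1 - α 2)) ≤ R := by linarith
  have h₂ : R ≤ (β 0 - β 2) * M - (β 0 - β 1) * ((α 0 - α 2) * (α 1 - α 2)) := by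
    have : (β 0 - β 2) * M - (β 0 - β 1) * ((α 0 - α 2) * (α 1 - α 2)) - R =
      -(α 2 + β 2 + γ 0) * (-(α 2 + β 2 + γ 1) * -(α 2 + β 2 + γ 2)) := by
      rw [hR, hM, eα, eβ, eγ]; ring
    linarith
  have h₃ : R ≤ (α 0 - α 2) * ((β 0 - β 2) * (β 0 - β 1)) - (α 1 - α 2) * M := by
    have : (α 0 - α 2) * ((β 0 - β 2) * (β 0 - β 1)) - (α 1 - α 2) * M - R =
      (α 1 + β 0 + γ 0) * (α 1 + β 0 + γ 1) * -(α 1 + β 0 + γ 2) := by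
      rw [hR, hM, eα, eβ, eγ]; ring
    linarith
  have h₄ : (α 1 - α 2) * ((β 0 - β 2) * (β 0 - β 1)) - (α 0 - α 2) * M ≤ R := by
    have : R - ((α 1 - α 2) * ((β 0 - β 2) * (β 0 - β 1)) - (α 0 - α 2) * M) =
      (α 0 + β 0 + γ 0) * (α 0 + β 0 + γ 1) * (α 0 + β 0 + γ 2) := by
      rw [hR, hM, eα, eβ, eγ]; ring
    linarith
  have hM₀ : (β 0 - β 1) * (α 1 - α 2) ≤ M := by
    rcases (show 0 ≤ α 0 - α 2 + (β 0 - β 2) by linarith).eq_or_lt with h0 | h0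
    · have a1 : α 1 = 0 := by linarith
      have a2 : α 2 = 0 := by linarith
      have b1 : β 1 = 0 := by linarith
      have b2 : β 2 = 0 := by linarith
      have c2 : γ 2 = 0 := by linarith
      have c1 : γ 1 = 0 := by linarith
      simp [hM, eα, eβ, eγ, a1, a2, b1, b2, c1, c2]
    · refine le_of_mul_le_mul_left ?_ h0
      linarith
  have hM₁ : M ≤ (β 0 - β 2) * (α 0 - α 2) := by
    rcases (show 0 ≤ α 1 - α 2 + (β 0 - β 1) by linarith).eq_or_lt with h0 | h0
    · have a1 : α 1 = α 2 := by linarith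
      have b1 : β 0 = β 1 := by linarith
      have c1 : γ 1 + α 2 + β 1 = 0 := by linarith
      have : (γ 2 + α 2 + β 1) * (γ 0 + α 2 + β 1) ≤ 0 :=
        mul_nonpos_of_nonpos_of_nonneg (by linarith)  (by linarith)
      rw [hM, a1, b1, c1]
      linarith
    · refine le_of_mul_le_mul_left ?_ h0
      linarith
  obtain ⟨X, Y, hX, hX', hY, hY', e, e'⟩ := exists_mul_eq_of_line (a := α 0 - α 1)
    (b := β 1 - β 2) (c := β 0 - β 1) (d := α 1 - α 2) (M := M) (R := R) (by linarith)
    (by linarith) (by linarith) (by linarith) hM₀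
    (by convert hM₁ using 1; ring) (by convert h₁ using 1; ring) (by convert h₂ using 1; ring)
    (by convert h₃ using 1; ring) (by convert h₄ using 1; ring)
  refine ⟨X, Y, hX, by linarith, hY, by linarith, by rw [e, hM], ?_⟩
  rw [e, ← hR, ← e']
  ring

theorem isA2Horn_of_mem_A2SideLengthCone {t : (Fin 3 → ℝ) × (Fin 3 → ℝ) × (Fin 3 → ℝ)}
    (ht : t ∈ A2SideLengthCone) : IsA2Horn t.1 t.2.1 t.2.2 := by
  obtain ⟨hα, hβ, hγ, A, B, C, tA, tB, tC, h, ⟨hA, σ, eA⟩, ⟨hB, τ, eB⟩, ⟨hC, υ, eC⟩⟩ := ht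
  have sA := sum_eq_zero_of_trace_eq_zero hA tA eA
  have sB := sum_eq_zero_of_trace_eq_zero hB tB eB
  have sC := sum_eq_zero_of_trace_eq_zero hC tC eC
  obtain ⟨U, hU, rfl⟩ := exists_unitary_diagonalization hA eA
  obtain ⟨V, hV, rfl⟩ := exists_unitary_diagonalization hB eB
  obtain ⟨W, hW, rfl⟩ := exists_unitary_diagonalization hC eC
  obtain ⟨_, _, _, _⟩ := horn_inequalities hα hβ hγ hU hV hW h
  obtain ⟨_, _, _, _⟩ := horn_inequalities hβ hγ hα hV hW hU (by rw [← h]; abel)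
  obtain ⟨_, _, _, _⟩ := horn_inequalities hγ hα hβ hW hU hV (by rw [← h]; abel)
  constructor <;> first | assumption | linarith

theorem mem_A2SideLengthCone_rotate {α β γ : Fin 3 → ℝ} (h : (α, β, γ) ∈ A2SideLengthCone) :
    (β, γ, α) ∈ A2SideLengthCone := by
  obtain ⟨hα, hβ, hγ, A, B, C, tA, tB, tC, h, hA, hB, hC⟩ := h
  exact ⟨hβ, hγ, hα, B, C, A, tB, tC, tA, by rw [← h]; abel, hB, hC, hA⟩

theorem IsA2Horn.mem_A2SideLengthCone_of_chart {α β γ : Fin 3 → ℝ} (h : IsA2Horn α β γ)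
    (hu : 0 ≤ α 2 + β 1 + γ 0) (hv : α 1 + β 0 + γ 2 ≤ 0) : (α, β, γ) ∈ A2SideLengthCone := by
  obtain ⟨X, Y, hX, hX', hY, hY', hM, hR⟩ := h.exists_parameters hu hv
  rw [hM] at hR
  have eα : α 0 = - α 1 - α 2 := by linarith [h.sum₁]
  have eβ : β 0 = - β 1 - β 2 := by linarith [h.sum₂]
  have eγ : γ 0 = - γ 1 - γ 2 := by linarith [h.sum₃]
  -- `s` and `t` are diagonal entries of the `2 × 2` blocks of the two summands
  obtain ⟨s, hs⟩ : ∃ s, s = β 1 - (β 0 - β 2) + X := ⟨_, rfl⟩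
  obtain ⟨t, ht⟩ : ∃ t, t = α 0 - Y + (α 1 - α 2) := ⟨_, rfl⟩
  have hu2 := Real.sq_sqrt (show 0 ≤ (t - α 1) * (α 0 - t) from
    mul_nonneg (by linarith) (by linarith))
  have hv2 := Real.sq_sqrt (show 0 ≤ (s - β 2) * (β 1 - s) from
    mul_nonneg (by linarith) (by linarith))
  obtain ⟨x, hx⟩ : ∃ x, x = √((t - α 1) * (α 0 - t)) := ⟨_, rfl⟩
  obtain ⟨y, hy⟩ : ∃ y, y = √((s - β 2) * (β 1 - s)) := ⟨_, rfl⟩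
  rw [← hx] at hu2
  rw [← hy] at hv2
  refine ⟨h.anti₁, h.anti₂, h.anti₃, tridiagonal (α 2) (α 0 + α 1 - t) t 0 x,
    tridiagonal s (β 1 + β 2 - s) (β 0) y 0,
    tridiagonal (-(α 2 + s)) (-(α 0 + α 1 - t + (β 1 + β 2 - s))) (-(t + β 0)) (-y) (-x),
    ?_, ?_, ?_, ?_, exists_perm_eigenvalues_tridiagonal ?_ ?_ ?_,
    exists_perm_eigenvalues_tridiagonal ?_ ?_ ?_, exists_perm_eigenvalues_tridiagonal ?_ ?_ ?_⟩
  · rw [trace_tridiagonal, Complex.ofReal_eq_zero]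
    linarith
  · rw [trace_tridiagonal, Complex.ofReal_eq_zero]
    linarith
  · rw [trace_tridiagonal, Complex.ofReal_eq_zero]
    linarith
  · ext i j
    fin_cases i <;> fin_cases j <;> simp [tridiagonal]
    all_goals ring
  · linarith
  · linear_combination -hu2
  · linear_combination -(α 2) * hu2
  · linarith
  · linear_combination -hv2
  · linear_combination -(β 0) * hv2
  · linarith
  · simp only [hs, ht, eα, eβ, eγ] at hu2 hv2 hM ⊢
    linear_combination -hu2 - hv2 + hM
  · simp only [hs, ht, eα, eβ, eγ] at hu2 hv2 hM hR ⊢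
    linear_combination (α 2 + (β 1 - (-β 1 - β 2 - β 2) + X)) * hu2 +
      (-α 1 - α 2 - Y + (α 1 - α 2) + (-β 1 - β 2)) * hv2 + hR + (β 1 + β 2 - α 2) * hM

theorem IsA2Horn.mem_A2SideLengthCone {α β γ : Fin 3 → ℝ} (h : IsA2Horn α β γ) :
    (α, β, γ) ∈ A2SideLengthCone := by
  have hsum : α 2 + β 1 + γ 0 + (α 1 + β 0 + γ 2) + (α 0 + β 2 + γ 1) = 0 := by
    linarith [h.sum₁, h.sum₂, h.sum₃]
  rcases le_total 0 (α 2 + β 1 + γ 0) with hu | hu <;>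
    rcases le_total 0 (α 1 + β 0 + γ 2) with hv | hv <;>
    rcases le_total 0 (α 0 + β 2 + γ 1) with hw | hw
  all_goals first
    | exact h.mem_A2SideLengthCone_of_chart (by linarith) (by linarith)
    | exact mem_A2SideLengthCone_rotate <| mem_A2SideLengthCone_rotate <|
        h.rotate.mem_A2SideLengthCone_of_chart (by linarith) (by linarith)
    | exact mem_A2SideLengthCone_rotate <|
        h.rotate.rotate.mem_A2SideLengthCone_of_chart (by linarith) (by linarith)

/-- The `Δ`-side length cone for `A₂` is the set of linear combinations with
nonnegative coefficients of the eight listed generators. -/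
theorem a2_cone_generators :
    A2SideLengthCone =
      { t | ∃ c : Fin 8 → ℝ, (∀ k, 0 ≤ c k) ∧ t = ∑ k, c k • A2Generators k } := by
  ext t
  rw [Set.mem_ofPred_eq, ← isA2Horn_iff_exists_sum_smul_A2Generators]
  exact ⟨isA2Horn_of_mem_A2SideLengthCone, IsA2Horn.mem_A2SideLengthCone⟩
end

section
/- Generators of the Δ-side length cone for B₂ = C₂: Let C ⊂ ℝ² × ℝ² × ℝ² be the set of all triples ((x₁,y₁),(x₂,y₂),(x₃,y₃)) with xᵢ ≥ yᵢ ≥ 0 for which there exist real skew-symmetric 5×5 matrices S₁, S₂, S₃ with S₁ + S₂ + S₃ = 0 such that for each i the multiset of eigenvalues of the Hermitian matrix i·Sᵢ is {xᵢ, yᵢ, 0, −yᵢ, −xᵢ}. Then C equals the set of all linear combinations with non-negative real coefficients of the following twelve triples: ((1,1),(1,1),(2,0)); ((1,0),(0,0),(1,0)); ((1,1),(1,1),(0,0)); ((1,1),(2,0),(1,1)); ((1,0),(1,0),(0,0)); ((1,0),(1,0),(1,1)); ((2,0),(1,1),(1,1)); ((0,0),(1,1),(1,1)); ((1,0),(1,1),(1,0));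 ((0,0),(1,0),(1,0)); ((1,1),(0,0),(1,1)); ((1,1),(1,0),(1,0)). -/
open Matrix

/-- The `Δ`-side length cone for `B₂ = C₂`: triples `h = ((x₁,y₁),(x₂,y₂),(x₃,y₃))`
with `xᵢ ≥ yᵢ ≥ 0` for which there are real skew-symmetric `5×5` matrices
`S₁, S₂, S₃` summing to zero such that the Hermitian matrix `i·Sᵢ` has
eigenvalue multiset `{xᵢ, yᵢ, 0, -yᵢ, -xᵢ}`. -/
def B2SideLengthCone : Set (Fin 3 → ℝ × ℝ) :=
  { h | (∀ i, (h i).2 ≤ (h i).1 ∧ 0 ≤ (h i).2) ∧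
    ∃ S : Fin 3 → Matrix (Fin 5) (Fin 5) ℝ,
      (∀ i, (S i)ᵀ = -(S i)) ∧ (∑ i, S i) = 0 ∧
      ∀ i, ∃ hh : (Complex.I • (S i).map (Complex.ofReal ·)).IsHermitian,
        ∃ τ : Equiv.Perm (Fin 5),
          ∀ j, hh.eigenvalues (τ j) = ![(h i).1, (h i).2, 0, -(h i).2, -(h i).1] j }

/-- The twelve generators of the `Δ`-side length cone `𝒫₃(B₂) = 𝒫₃(C₂)`. -/
noncomputable def B2Generators : Fin 12 → (Fin 3 → ℝ × ℝ) :=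
  ![![(1, 1), (1, 1), (2, 0)],
    ![(1, 0), (0, 0), (1, 0)],
    ![(1, 1), (1, 1), (0, 0)],
    ![(1, 1), (2, 0), (1, 1)],
    ![(1, 0), (1, 0), (0, 0)],
    ![(1, 0), (1, 0), (1, 1)],
    ![(2, 0), (1, 1), (1, 1)],
    ![(0, 0), (1, 1), (1, 1)],
    ![(1, 0), (1, 1), (1, 0)],
    ![(0, 0), (1, 0), (1, 0)],
    ![(1, 1), (0, 0), (1, 1)],
    ![(1, 1), (1, 0), (1, 0)]]


/-- The facet inequalities of the side length cone. -/
structure B2Facets (x y : Fin 3 → ℝ) : Prop where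
  le : ∀ i, y i ≤ x i
  nonneg : ∀ i, 0 ≤ y i
  fst_le : ∀ i j k, i ≠ j → j ≠ k → i ≠ k → x i ≤ x j + x k
  add_le : ∀ i j k, i ≠ j → j ≠ k → i ≠ k → x i + y i ≤ x j + y j + (x k + y k)
  snd_le : ∀ i j k, i ≠ j → j ≠ k → i ≠ k → y i ≤ y j + x k
  sub_le : ∀ i j k, i ≠ j → j ≠ k → i ≠ k → x i - y i ≤ x j - y j + (x k + y k)

set_option maxHeartbeats 2000000 in
theorem B2Facets.mem_cone {h : Fin 3 → ℝ × ℝ}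
    (H : B2Facets (fun i => (h i).1) (fun i => (h i).2)) :
    ∃ c : Fin 12 → ℝ, (∀ k, 0 ≤ c k) ∧ h = ∑ k, c k • B2Generators k := by
  obtain ⟨h1, h2, h3, h4, h5, h6⟩ := H
  obtain ⟨x1, hx1⟩ : ∃ t, t = (h 0).1 := ⟨_, rfl⟩
  obtain ⟨x2, hx2⟩ : ∃ t, t = (h 1).1 := ⟨_, rfl⟩
  obtain ⟨x3, hx3⟩ : ∃ t, t = (h 2).1 := ⟨_, rfl⟩
  obtain ⟨y1, hy1⟩ : ∃ t, t = (h 0).2 := ⟨_, rfl⟩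
  obtain ⟨y2, hy2⟩ : ∃ t, t = (h 1).2 := ⟨_, rfl⟩
  obtain ⟨y3, hy3⟩ : ∃ t, t = (h 2).2 := ⟨_, rfl⟩
  have hh : h = ![(x1, y1), (x2, y2), (x3, y3)] := by
    ext i <;> fin_cases i <;> simp [*]
  simp [Fin.forall_fin_succ, ← hx1, ← hx2, ← hx3, ← hy1, ← hy2, ← hy3] at h1 h2 h3 h4 h5 h6
  obtain ⟨e1, he1⟩ : ∃ e, e = max 0 (y1 - y2 - y3) := ⟨_, rfl⟩
  obtain ⟨e2, he2⟩ : ∃ e, e = max 0 (y2 - y3 - y1) := ⟨_, rfl⟩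
  obtain ⟨e3, he3⟩ : ∃ e, e = max 0 (y3 - y1 - y2) := ⟨_, rfl⟩
  obtain ⟨b1, hb1⟩ : ∃ b, b = ((x2 - y2) + (x3 - y3) - (x1 - y1)) / 2 - e1 := ⟨_, rfl⟩
  obtain ⟨b2, hb2⟩ : ∃ b, b = ((x3 - y3) + (x1 - y1) - (x2 - y2)) / 2 - e2 := ⟨_, rfl⟩
  obtain ⟨b3, hb3⟩ : ∃ b, b = ((x1 - y1) + (x2 - y2) - (x3 - y3)) / 2 - e3 := ⟨_, rfl⟩
  obtain ⟨a1, ha1⟩ : ∃ a, a = max 0 (-b1) := ⟨_, rfl⟩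
  obtain ⟨a2, ha2⟩ : ∃ a, a = max 0 (-b2) := ⟨_, rfl⟩
  obtain ⟨a3, ha3⟩ : ∃ a, a = max 0 (-b3) := ⟨_, rfl⟩
  refine ⟨![a3, b2 + a2 - a3 - a1, (y1 + y2 - y3) / 2 + e3 / 2 - (e1 + e2) / 2 - a3, a2,
    b3 + a3 - a1 - a2, e3, a1, (y2 + y3 - y1) / 2 + e1 / 2 - (e2 + e3) / 2 - a1, e2,
    b1 + a1 - a2 - a3, (y3 + y1 - y2) / 2 + e2 / 2 - (e3 + e1) / 2 - a2, e1], ?_, ?_⟩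
  · have key : ∀ t s : ℝ, t = max 0 s → 0 ≤ t ∧ (t = 0 ∧ s ≤ 0 ∨ t = s ∧ 0 ≤ s) := by
      rintro t s rfl
      rcases le_total s 0 with hs | hs <;> simp [hs]
    obtain ⟨e1', he1⟩ := key _ _ he1
    obtain ⟨e2', he2⟩ := key _ _ he2
    obtain ⟨e3', he3⟩ := key _ _ he3
    obtain ⟨a1', ha1⟩ := key _ _ ha1
    obtain ⟨a2', ha2⟩ := key _ _ ha2
    obtain ⟨a3', ha3⟩ := key _ _ ha3
    clear key hx1 hx2 hx3 hy1 hy2 hy3 hh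
    have goals : 0 ≤ b2 + a2 - a3 - a1 ∧ 0 ≤ b3 + a3 - a1 - a2 ∧ 0 ≤ b1 + a1 - a2 - a3 ∧
        0 ≤ (y1 + y2 - y3) / 2 + e3 / 2 - (e1 + e2) / 2 - a3 ∧
        0 ≤ (y2 + y3 - y1) / 2 + e1 / 2 - (e2 + e3) / 2 - a1 ∧
        0 ≤ (y3 + y1 - y2) / 2 + e2 / 2 - (e3 + e1) / 2 - a2 := by
      obtain ⟨⟨_, _⟩, ⟨_, _⟩, _, _⟩ := h3
      obtain ⟨⟨_, _⟩, ⟨_, _⟩, _, _⟩ := h4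
      obtain ⟨⟨_, _⟩, ⟨_, _⟩, _, _⟩ := h5
      obtain ⟨⟨_, _⟩, ⟨_, _⟩, _, _⟩ := h6
      obtain ⟨_, _, _⟩ := h1
      obtain ⟨_, _, _⟩ := h2
      rcases he1 with ⟨rfl, _⟩ | ⟨he1, _⟩ <;> rcases he2 with ⟨rfl, _⟩ | ⟨he2, _⟩ <;>
      rcases he3 with ⟨rfl, _⟩ | ⟨he3, _⟩ <;>
      rcases ha1 with ⟨rfl, _⟩ | ⟨ha1, _⟩ <;> rcases ha2 with ⟨rfl, _⟩ | ⟨ha2, _⟩ <;>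
      rcases ha3 with ⟨rfl, _⟩ | ⟨ha3, _⟩ <;>
      refine ⟨?_, ?_, ?_, ?_, ?_, ?_⟩ <;> linarith
    obtain ⟨g1, g2, g3, g4, g5, g6⟩ := goals
    simp [Fin.forall_fin_succ]
    exact ⟨a3', by linarith, by linarith, a2', by linarith, e3', a1', by linarith, e2',
      by linarith, by linarith, e1'⟩
  · rw [hh]
    clear h1 h2 h3 h4 h5 h6
    ext i <;> fin_cases i <;>
      simp [Fin.sum_univ_succ, B2Generators, Fin.succ] <;> linarith

theorem B2Facets.of_cone {c : Fin 12 → ℝ} (hc : ∀ k, 0 ≤ c k) :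
    B2Facets (fun i => ((∑ k, c k • B2Generators k) i).1)
      (fun i => ((∑ k, c k • B2Generators k) i).2) := by
  have h0 := hc 0
  have h1 := hc 1
  have h2 := hc 2
  have h3 := hc 3
  have h4 := hc 4
  have h5 := hc 5
  have h6 := hc 6
  have h7 := hc 7
  have h8 := hc 8
  have h9 := hc 9
  have h10 := hc 10
  have h11 := hc 11
  have hs : ∑ k, c k • B2Generators k =
      ![(2 * c 6 + c 0 + c 1 + c 2 + c 3 + c 4 + c 5 + c 8 + c 10 + c 11,
          c 0 + c 2 + c 3 + c 10 + c 11),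
        (2 * c 3 + c 0 + c 2 + c 4 + c 5 + c 6 + c 7 + c 8 + c 9 + c 11,
          c 0 + c 2 + c 6 + c 7 + c 8),
        (2 * c 0 + c 1 + c 3 + c 5 + c 6 + c 7 + c 8 + c 9 + c 10 + c 11,
          c 3 + c 5 + c 6 + c 7 + c 10)] := by
    ext i <;> fin_cases i <;>
      simp [Fin.sum_univ_succ, B2Generators, Fin.succ] <;> ring
  rw [hs]
  constructor <;> simp [Fin.forall_fin_succ] <;> refine ⟨?_, ?_, ?_⟩ <;>
    first | positivity | linarith | (refine ⟨?_, ?_⟩ <;> linarith)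

section Spectral

variable {E : Type*} [NormedAddCommGroup E] [InnerProductSpace ℂ E] {n : ℕ}

open scoped InnerProductSpace

/-- The Hermitian form with eigenvalues `a` in the orthonormal basis `v`. -/
noncomputable def diagForm (v : OrthonormalBasis (Fin n) ℂ E) (a : Fin n → ℝ) (z : E) : ℝ :=
  ∑ j, a j * ‖⟪v j, z⟫_ℂ‖ ^ 2

theorem diagForm_const (v : OrthonormalBasis (Fin n) ℂ E) (c : ℝ) (z : E) :
    diagForm v (fun _ => c) z = c * ‖z‖ ^ 2 := by
  rw [diagForm, ← Finset.mul_sum, v.sum_sq_norm_inner_right]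

theorem diagForm_add_const (v : OrthonormalBasis (Fin n) ℂ E) (a : Fin n → ℝ) (c : ℝ) (z : E) :
    diagForm v (fun j => a j + c) z = diagForm v a z + c * ‖z‖ ^ 2 := by
  rw [← diagForm_const v c z, diagForm, diagForm, diagForm, ← Finset.sum_add_distrib]
  exact Finset.sum_congr rfl fun j _ => add_mul _ _ _

theorem diagForm_apply_self (v : OrthonormalBasis (Fin n) ℂ E) (a : Fin n → ℝ) (j : Fin n) :
    diagForm v a (v j) = a j := by
  simp [diagForm, OrthonormalBasis.inner_eq_ite, apply_ite]

theorem re_inner_apply_eq_diagForm (v : OrthonormalBasis (Fin n) ℂ E) {a : Fin n → ℝ}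
    {T : E →ₗ[ℂ] E} (h : ∀ j, T (v j) = (a j : ℂ) • v j) (z : E) :
    (⟪z, T z⟫_ℂ).re = diagForm v a z := by
  conv_lhs => rw [← v.sum_repr' z]
  simp only [map_sum, map_smul, h, inner_sum, inner_smul_right, sum_inner, inner_smul_left]
  simp [OrthonormalBasis.inner_eq_ite, diagForm, ← Complex.normSq_eq_norm_sq,
    Complex.normSq_apply]
  rw [← Finset.sum_sub_distrib]
  refine Finset.sum_congr rfl fun j _ => ?_
  rw [← inner_conj_symm z, Complex.conj_re, Complex.conj_im]
  ring

/-- Weyl's monotonicity principle. -/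
theorem le_of_diagForm_le {v w : OrthonormalBasis (Fin n) ℂ E} {a b : Fin n → ℝ}
    (ha : Antitone a) (hb : Antitone b) (h : ∀ z, diagForm v a z ≤ diagForm w b z) (i : Fin n) :
    a i ≤ b i := by
  have : FiniteDimensional ℂ E := v.toBasis.finiteDimensional_of_finite
  let f : E →ₗ[ℂ] ({j // j ≠ i} → ℂ) :=
    LinearMap.pi fun j => (innerSL ℂ (if j.1 < i then w j else v j) : E →ₗ[ℂ] ℂ)
  have hf : LinearMap.ker f ≠ ⊥ := by
    refine LinearMap.ker_ne_bot_of_finrank_lt ?_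
    rw [Module.finrank_fintype_fun_eq_card, Module.finrank_eq_card_basis v.toBasis]
    exact Fintype.card_subtype_lt (x := i) (by simp)
  obtain ⟨z, hz, hz0⟩ := Submodule.exists_mem_ne_zero_of_ne_bot hf
  have hz' : ∀ j, j ≠ i → ⟪if j < i then w j else v j, z⟫_ℂ = 0 := fun j hj =>
    congrFun (LinearMap.mem_ker.1 hz) ⟨j, hj⟩
  have h1 : a i * ‖z‖ ^ 2 ≤ diagForm v a z := by
    rw [← diagForm_const v]
    refine Finset.sum_le_sum fun j _ => ?_
    rcases le_or_gt j i with hj | hj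
    · exact mul_le_mul_of_nonneg_right (ha hj) (sq_nonneg _)
    · have := hz' j hj.ne'
      rw [if_neg hj.not_gt] at this
      simp [this]
  have h2 : diagForm w b z ≤ b i * ‖z‖ ^ 2 := by
    rw [← diagForm_const w]
    refine Finset.sum_le_sum fun j _ => ?_
    rcases le_or_gt i j with hj | hj
    · exact mul_le_mul_of_nonneg_right (hb hj) (sq_nonneg _)
    · have := hz' j hj.ne
      rw [if_pos hj] at this
      simp [this]
  have hpos : 0 < ‖z‖ ^ 2 := by positivity
  exact le_of_mul_le_mul_right ((h1.trans (h z)).trans h2) hpos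

/-- Weyl's inequality for the largest eigenvalue of the second summand. -/
theorem le_add_of_diagForm_le {v w u : OrthonormalBasis (Fin (n + 1)) ℂ E}
    {a b c : Fin (n + 1) → ℝ} (ha : Antitone a) (hb : Antitone b) (hc : Antitone c)
    (h : ∀ z, diagForm v a z ≤ diagForm w b z + diagForm u c z) (i : Fin (n + 1)) :
    a i ≤ b i + c 0 := by
  refine le_of_diagForm_le (v := v) (w := w) (b := fun j => b j + c 0) ha
    (fun _ _ hij => add_le_add_left (hb hij) _) (fun z => (h z).trans ?_) i
  rw [diagForm_add_const, ← diagForm_const u]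
  exact add_le_add_right (Finset.sum_le_sum fun j _ =>
    mul_le_mul_of_nonneg_right (hc (Fin.zero_le j)) (sq_nonneg _)) _

/-- A rank one update of a Hermitian form raises the eigenvalues by a total of its weight. -/
theorem exists_diagForm_eq_add (w : OrthonormalBasis (Fin n) ℂ E) (b : Fin n → ℝ) (g : ℝ)
    {u : E} (hu : ‖u‖ = 1) :
    ∃ (m : OrthonormalBasis (Fin n) ℂ E) (μ : Fin n → ℝ), Antitone μ ∧
      (∀ z, diagForm m μ z = diagForm w b z + g * ‖⟪u, z⟫_ℂ‖ ^ 2) ∧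
      ∑ j, μ j = ∑ j, b j + g := by
  have : FiniteDimensional ℂ E := w.toBasis.finiteDimensional_of_finite
  have hn : Module.finrank ℂ E = n := by
    rw [Module.finrank_eq_card_basis w.toBasis, Fintype.card_fin]
  let T : E →ₗ[ℂ] E := (∑ j, (b j : ℂ) • (innerSL ℂ (w j) : E →ₗ[ℂ] ℂ).smulRight (w j)) +
    (g : ℂ) • (innerSL ℂ u : E →ₗ[ℂ] ℂ).smulRight u
  have hTa : ∀ z, T z = (∑ j, (b j : ℂ) • ⟪w j, z⟫_ℂ • w j) + (g : ℂ) • ⟪u, z⟫_ℂ • u := fun z => by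
    simp [T]
  have hT : T.IsSymmetric := by
    intro x y
    simp only [hTa, inner_add_left, inner_add_right, sum_inner, inner_sum, inner_smul_left,
      inner_smul_right, inner_conj_symm, Complex.conj_ofReal]
    congr 1
    · exact Finset.sum_congr rfl fun j _ => by ring
    · ring
  have hQ : ∀ z, diagForm (hT.eigenvectorBasis hn) (hT.eigenvalues hn) z =
      diagForm w b z + g * ‖⟪u, z⟫_ℂ‖ ^ 2 := fun z => by
    rw [← re_inner_apply_eq_diagForm (a := hT.eigenvalues hn) _
      (hT.apply_eigenvectorBasis hn), hTa]
    simp only [inner_add_right, inner_sum, inner_smul_right, Complex.add_re, Complex.re_sum,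
      diagForm]
    have hre : ∀ (t : ℝ) (x : E), ((t : ℂ) * (⟪x, z⟫_ℂ * ⟪z, x⟫_ℂ)).re = t * ‖⟪x, z⟫_ℂ‖ ^ 2 := by
      intro t x
      rw [← inner_conj_symm z x, Complex.mul_conj, Complex.normSq_eq_norm_sq]
      norm_cast
    simp only [hre]
  refine ⟨hT.eigenvectorBasis hn, hT.eigenvalues hn, hT.eigenvalues_antitone hn, hQ, ?_⟩
  have h1 : ∀ j, hT.eigenvalues hn j = diagForm w b (hT.eigenvectorBasis hn j) +
      g * ‖⟪u, hT.eigenvectorBasis hn j⟫_ℂ‖ ^ 2 := fun j => by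
    rw [← hQ, diagForm_apply_self]
  have h2 : ∀ x : E, ∑ j, ‖⟪x, hT.eigenvectorBasis hn j⟫_ℂ‖ ^ 2 = ‖x‖ ^ 2 :=
    (hT.eigenvectorBasis hn).sum_sq_norm_inner_left
  rw [Finset.sum_congr rfl fun j _ => h1 j, Finset.sum_add_distrib, ← Finset.mul_sum, h2, hu]
  simp only [diagForm]
  rw [Finset.sum_comm]
  simp [← Finset.mul_sum, h2]

/-- Lidskii's inequality for two eigenvalues. -/
theorem add_le_add_of_diagForm_le {v w u : OrthonormalBasis (Fin (n + 2)) ℂ E}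
    {a b c : Fin (n + 2) → ℝ} (ha : Antitone a) (hb : Antitone b) (hc : Antitone c)
    (h : ∀ z, diagForm v a z ≤ diagForm w b z + diagForm u c z) {i l : Fin (n + 2)}
    (hil : i ≠ l) : a i + a l ≤ b i + b l + (c 0 + c 1) := by
  have hg : 0 ≤ c 0 - c 1 := sub_nonneg.2 (hc (Fin.zero_le 1))
  obtain ⟨m, μ, hμ, hm, hsum⟩ := exists_diagForm_eq_add w b (c 0 - c 1) (u.norm_eq_one 0)
  have hbμ : ∀ j, b j ≤ μ j := le_of_diagForm_le hb hμ fun z => by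
    rw [hm]
    exact le_add_of_nonneg_right (mul_nonneg hg (sq_nonneg _))
  have haμ : ∀ j, a j ≤ μ j + c 1 := by
    refine le_of_diagForm_le (v := v) (w := m) ha (fun _ _ hij => add_le_add_left (hμ hij) _)
      fun z => (h z).trans ?_
    rw [diagForm_add_const, hm, add_assoc, ← diagForm_const u, add_le_add_iff_left, diagForm,
      diagForm, Fin.sum_univ_succ, Fin.sum_univ_succ (fun j => c 1 * _), ← add_assoc, ← add_mul,
      sub_add_cancel]
    refine add_le_add_right (Finset.sum_le_sum fun j _ =>
      mul_le_mul_of_nonneg_right (hc ?_) (sq_nonneg _)) _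
    rw [Fin.le_iff_val_le_val]
    simp
  have hpair : (μ i - b i) + (μ l - b l) ≤ c 0 - c 1 := by
    have := Finset.sum_le_sum_of_subset_of_nonneg (Finset.subset_univ {i, l})
      fun j _ _ => sub_nonneg.2 (hbμ j)
    rw [Finset.sum_pair hil, Finset.sum_sub_distrib, hsum] at this
    linarith
  linarith [haμ i, haμ l]

end Spectral

theorem antitone_spectrum {x y : ℝ} (hy : 0 ≤ y) (hyx : y ≤ x) :
    Antitone ![x, y, 0, -y, -x] := by
  refine Fin.antitone_iff_succ_le.2 fun i => ?_
  fin_cases i <;> simp [hy, hyx]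

theorem exists_re_inner_eq_diagForm {S : Matrix (Fin 5) (Fin 5) ℝ} {x y : ℝ}
    (h : ∃ hh : (Complex.I • S.map (Complex.ofReal ·)).IsHermitian,
      ∃ τ : Equiv.Perm (Fin 5), ∀ j, hh.eigenvalues (τ j) = ![x, y, 0, -y, -x] j) :
    (∃ v : OrthonormalBasis (Fin 5) ℂ (EuclideanSpace ℂ (Fin 5)), ∀ z,
      (inner ℂ z ((Complex.I • S.map (Complex.ofReal ·)).toEuclideanLin z)).re =
        diagForm v ![x, y, 0, -y, -x] z) ∧
    ∃ w : OrthonormalBasis (Fin 5) ℂ (EuclideanSpace ℂ (Fin 5)), ∀ z,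
      -(inner ℂ z ((Complex.I • S.map (Complex.ofReal ·)).toEuclideanLin z)).re =
        diagForm w ![x, y, 0, -y, -x] z := by
  obtain ⟨hh, τ, hτ⟩ := h
  have hv : ∀ z, (inner ℂ z ((Complex.I • S.map (Complex.ofReal ·)).toEuclideanLin z)).re =
      diagForm (hh.eigenvectorBasis.reindex τ.symm) ![x, y, 0, -y, -x] z := fun z => by
    refine re_inner_apply_eq_diagForm _ (fun j => ?_) z
    rw [OrthonormalBasis.reindex_apply, Equiv.symm_symm, ← hτ]
    rw [Matrix.toLpLin_apply, hh.mulVec_eigenvectorBasis]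
    rfl
  refine ⟨⟨_, hv⟩, hh.eigenvectorBasis.reindex (τ.symm.trans Fin.revPerm), fun z => ?_⟩
  rw [hv z, diagForm, diagForm]
  simp [Fin.sum_univ_five, OrthonormalBasis.reindex_apply, Fin.rev]
  ring

theorem facets_of_sum_eq_zero {Si Sj Sk : Matrix (Fin 5) (Fin 5) ℝ} {xi yi xj yj xk yk : ℝ}
    (hS : Si + Sj + Sk = 0) (hi : yi ≤ xi ∧ 0 ≤ yi) (hj : yj ≤ xj ∧ 0 ≤ yj)
    (hk : yk ≤ xk ∧ 0 ≤ yk)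
    (Hi : ∃ hh : (Complex.I • Si.map (Complex.ofReal ·)).IsHermitian,
      ∃ τ : Equiv.Perm (Fin 5), ∀ j, hh.eigenvalues (τ j) = ![xi, yi, 0, -yi, -xi] j)
    (Hj : ∃ hh : (Complex.I • Sj.map (Complex.ofReal ·)).IsHermitian,
      ∃ τ : Equiv.Perm (Fin 5), ∀ j, hh.eigenvalues (τ j) = ![xj, yj, 0, -yj, -xj] j)
    (Hk : ∃ hh : (Complex.I • Sk.map (Complex.ofReal ·)).IsHermitian,
      ∃ τ : Equiv.Perm (Fin 5), ∀ j, hh.eigenvalues (τ j) = ![xk, yk, 0, -yk, -xk] j) :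
    xi ≤ xj + xk ∧ xi + yi ≤ xj + yj + (xk + yk) ∧ yi ≤ yj + xk ∧
      xi - yi ≤ xj - yj + (xk + yk) := by
  obtain ⟨-, v, hv⟩ := exists_re_inner_eq_diagForm Hi
  obtain ⟨⟨w, hw⟩, -⟩ := exists_re_inner_eq_diagForm Hj
  obtain ⟨⟨u, hu⟩, -⟩ := exists_re_inner_eq_diagForm Hk
  have h : ∀ z, diagForm v ![xi, yi, 0, -yi, -xi] z ≤
      diagForm w ![xj, yj, 0, -yj, -xj] z + diagForm u ![xk, yk, 0, -yk, -xk] z := fun z => by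
    rw [← hv, ← hw, ← hu]
    have hz : (Complex.I • Si.map (Complex.ofReal ·)) + (Complex.I • Sj.map (Complex.ofReal ·)) +
        (Complex.I • Sk.map (Complex.ofReal ·)) = 0 := by
      ext a b
      have := congrFun (congrFun hS a) b
      simp only [Matrix.add_apply, Matrix.zero_apply] at this
      simp [← mul_add, ← Complex.ofReal_add, this]
    have := congrArg (fun M : Matrix (Fin 5) (Fin 5) ℂ => (inner ℂ z (M.toEuclideanLin z)).re) hz
    simp only [map_add, LinearMap.add_apply, inner_add_right, Complex.add_re, map_zero,
      LinearMap.zero_apply, inner_zero_right, Complex.zero_re] at this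
    linarith
  have ha := antitone_spectrum hi.2 hi.1
  have hb := antitone_spectrum hj.2 hj.1
  have hc := antitone_spectrum hk.2 hk.1
  refine ⟨le_add_of_diagForm_le ha hb hc h 0, ?_, le_add_of_diagForm_le ha hb hc h 1, ?_⟩
  · exact add_le_add_of_diagForm_le ha hb hc h (i := 0) (l := 1) (by decide)
  · exact add_le_add_of_diagForm_le ha hb hc h (i := 0) (l := 3) (by decide)

theorem b2Facets_of_mem_cone {h : Fin 3 → ℝ × ℝ} (H : h ∈ B2SideLengthCone) :
    B2Facets (fun i => (h i).1) (fun i => (h i).2) := by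
  obtain ⟨hc, S, -, hS, hE⟩ := H
  have key : ∀ i j k, i ≠ j → j ≠ k → i ≠ k → S i + S j + S k = 0 := by
    intro i j k hij hjk hik
    have huniv : (Finset.univ : Finset (Fin 3)) = {i, j, k} := by decide +revert
    rw [← hS, huniv, Finset.sum_insert (by simp [hij, hik]), Finset.sum_pair hjk, add_assoc]
  have := fun i j k hij hjk hik =>
    facets_of_sum_eq_zero (key i j k hij hjk hik) (hc i) (hc j) (hc k) (hE i) (hE j) (hE k)
  exact ⟨fun i => (hc i).1, fun i => (hc i).2, fun i j k h1 h2 h3 => (this i j k h1 h2 h3).1,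
    fun i j k h1 h2 h3 => (this i j k h1 h2 h3).2.1,
    fun i j k h1 h2 h3 => (this i j k h1 h2 h3).2.2.1,
    fun i j k h1 h2 h3 => (this i j k h1 h2 h3).2.2.2⟩

/-- The vector `z = ((U + V) / 2, i (U - V) / 2, T / √2)` of `ℂ³` satisfies
`|z|² = (p² + q²) / 2` and `|z ⬝ z| = p q`. -/
def IsSpin (p q : ℝ) (U V T : ℂ) : Prop :=
  ‖U‖ ^ 2 + ‖V‖ ^ 2 + ‖T‖ ^ 2 = p ^ 2 + q ^ 2 ∧ ‖U * V + T ^ 2 / 2‖ = p * q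

/-- There is a closed triangle in `ℂ³` whose sides have the invariants `(pᵢ, qᵢ)`. -/
def Closes (p₁ q₁ p₂ q₂ p₃ q₃ : ℝ) : Prop :=
  ∃ U₁ V₁ T₁ U₂ V₂ T₂ U₃ V₃ T₃ : ℂ, IsSpin p₁ q₁ U₁ V₁ T₁ ∧ IsSpin p₂ q₂ U₂ V₂ T₂ ∧
    IsSpin p₃ q₃ U₃ V₃ T₃ ∧ U₁ + U₂ + U₃ = 0 ∧ V₁ + V₂ + V₃ = 0 ∧ T₁ + T₂ + T₃ = 0

section Closing

variable {p₁ q₁ p₂ q₂ p₃ q₃ : ℝ}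

theorem Closes.rotate (h : Closes p₁ q₁ p₂ q₂ p₃ q₃) : Closes p₂ q₂ p₃ q₃ p₁ q₁ := by
  obtain ⟨U₁, V₁, T₁, U₂, V₂, T₂, U₃, V₃, T₃, h1, h2, h3, hU, hV, hT⟩ := h
  exact ⟨U₂, V₂, T₂, U₃, V₃, T₃, U₁, V₁, T₁, h2, h3, h1, by linear_combination hU,
    by linear_combination hV, by linear_combination hT⟩

theorem Closes.swap (h : Closes p₁ q₁ p₂ q₂ p₃ q₃) : Closes p₂ q₂ p₁ q₁ p₃ q₃ := by
  obtain ⟨U₁, V₁, T₁, U₂, V₂, T₂, U₃, V₃, T₃, h1, h2, h3, hU, hV, hT⟩ := h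
  exact ⟨U₂, V₂, T₂, U₁, V₁, T₁, U₃, V₃, T₃, h2, h1, h3, by linear_combination hU,
    by linear_combination hV, by linear_combination hT⟩

theorem exists_norm_eq_one_re_eq {c : ℝ} (hc : |c| ≤ 1) : ∃ e : ℂ, ‖e‖ = 1 ∧ e.re = c := by
  refine ⟨⟨c, √(1 - c ^ 2)⟩, ?_, rfl⟩
  have h : 0 ≤ 1 - c ^ 2 := by
    have := (sq_le_one_iff_abs_le_one c).2 hc
    linarith
  rw [← sq_eq_sq₀ (norm_nonneg _) zero_le_one, Complex.sq_norm, Complex.normSq_mk,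
    Real.mul_self_sqrt h]
  ring

theorem norm_add_real_mul_sq (a b : ℝ) {e : ℂ} (he : ‖e‖ = 1) :
    ‖(a : ℂ) + b * e‖ ^ 2 = a ^ 2 + b ^ 2 + 2 * a * b * e.re := by
  have h : e.re * e.re + e.im * e.im = 1 := by
    rw [← Complex.normSq_apply, ← Complex.sq_norm, he, one_pow]
  rw [Complex.sq_norm, Complex.normSq_apply]
  simp
  linear_combination b ^ 2 * h

theorem exists_closed_triangle {a b c : ℝ} (ha : 0 ≤ a) (hb : 0 ≤ b) (hc : 0 ≤ c)
    (h1 : a ≤ b + c) (h2 : b ≤ c + a) (h3 : c ≤ a + b) :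
    ∃ u v w : ℂ, ‖u‖ = a ∧ ‖v‖ = b ∧ ‖w‖ = c ∧ u + v + w = 0 := by
  obtain ⟨t, ht, htc⟩ : ∃ t : ℝ, |t| ≤ 1 ∧ a ^ 2 + b ^ 2 + 2 * a * b * t = c ^ 2 := by
    have hab := mul_nonneg ha hb
    rcases hab.eq_or_lt with h0 | h0
    · refine ⟨0, by simp, ?_⟩
      rcases mul_eq_zero.1 h0.symm with rfl | rfl
      · rw [show b = c by linarith]; ring
      · rw [show a = c by linarith]; ring
    · refine ⟨(c ^ 2 - a ^ 2 - b ^ 2) / (2 * (a * b)), ?_, ?_⟩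
      · rw [abs_le, le_div_iff₀ (by positivity), div_le_iff₀ (by positivity)]
        constructor <;> nlinarith
      · have : a ≠ 0 := by rintro rfl; simp at h0
        have : b ≠ 0 := by rintro rfl; simp at h0
        field_simp
        ring
  obtain ⟨e, he, rfl⟩ := exists_norm_eq_one_re_eq ht
  refine ⟨a, b * e, -(a + b * e), ?_, ?_, ?_, by ring⟩
  · simp [abs_of_nonneg ha]
  · simp [abs_of_nonneg hb, he]
  · rw [norm_neg, ← sq_eq_sq₀ (norm_nonneg _) hc, norm_add_real_mul_sq _ _ he, htc]

theorem Closes.of_triangles {a₁ b₁ a₂ b₂ a₃ b₃ : ℝ} (ha₁ : 0 ≤ a₁) (hb₁ : 0 ≤ b₁)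
    (ha₂ : 0 ≤ a₂) (hb₂ : 0 ≤ b₂) (ha₃ : 0 ≤ a₃) (hb₃ : 0 ≤ b₃)
    (h1 : a₁ ≤ a₂ + a₃) (h2 : a₂ ≤ a₃ + a₁) (h3 : a₃ ≤ a₁ + a₂)
    (k1 : b₁ ≤ b₂ + b₃) (k2 : b₂ ≤ b₃ + b₁) (k3 : b₃ ≤ b₁ + b₂) :
    Closes a₁ b₁ a₂ b₂ a₃ b₃ := by
  obtain ⟨U₁, U₂, U₃, rfl, rfl, rfl, hU⟩ := exists_closed_triangle ha₁ ha₂ ha₃ h1 h2 h3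
  obtain ⟨V₁, V₂, V₃, rfl, rfl, rfl, hV⟩ := exists_closed_triangle hb₁ hb₂ hb₃ k1 k2 k3
  exact ⟨U₁, V₁, 0, U₂, V₂, 0, U₃, V₃, 0, by simp [IsSpin], by simp [IsSpin], by simp [IsSpin],
    hU, hV, by simp⟩

theorem IsSpin.comm {p q : ℝ} {U V T : ℂ} (h : IsSpin p q U V T) : IsSpin q p U V T :=
  ⟨h.1.trans (add_comm _ _), h.2.trans (mul_comm _ _)⟩

theorem Closes.comm_fst (h : Closes p₁ q₁ p₂ q₂ p₃ q₃) : Closes q₁ p₁ p₂ q₂ p₃ q₃ := by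
  obtain ⟨U₁, V₁, T₁, U₂, V₂, T₂, U₃, V₃, T₃, h1, h⟩ := h
  exact ⟨U₁, V₁, T₁, U₂, V₂, T₂, U₃, V₃, T₃, h1.comm, h⟩

/-- The value of `|U₃ V₃ + T₃² / 2|²` along a one-parameter family of triangles whose first side
has `T₁ = 0` and whose second side has `|U₂| = U` and `|V₂| = p₂ + q₂ - U`. -/
noncomputable def familyInvariant (p₁ q₁ p₂ q₂ K U : ℝ) : ℝ :=
  p₁ ^ 2 * (q₁ + (p₂ + q₂ - U)) ^ 2 + (U * q₁ + p₂ * q₂) ^ 2 +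
    2 * (q₁ + (p₂ + q₂ - U)) * (q₁ + p₂ * q₂ / U) * (K - q₁ * (p₂ + q₂ - U))

theorem div_mul_self_of_le {U : ℝ} (hq₂ : 0 ≤ q₂) (hU : q₂ ≤ U) :
    p₂ * q₂ / U * U = p₂ * q₂ := by
  rcases eq_or_ne U 0 with rfl | h
  · simp [le_antisymm hU hq₂]
  · field_simp

theorem Closes.of_familyInvariant_eq {K U : ℝ} (hp₁ : 0 ≤ p₁) (hq₁ : 0 ≤ q₁) (hq₂ : 0 ≤ q₂)
    (hp₃ : 0 ≤ p₃) (hq₃ : 0 ≤ q₃) (hU : q₂ ≤ U) (hU' : U ≤ p₂)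
    (hK : p₁ ^ 2 + q₁ ^ 2 + p₂ ^ 2 + q₂ ^ 2 + 2 * K = p₃ ^ 2 + q₃ ^ 2)
    (hc : |K - q₁ * (p₂ + q₂ - U)| ≤ p₁ * U)
    (h : familyInvariant p₁ q₁ p₂ q₂ K U = (p₃ * q₃) ^ 2) :
    Closes p₁ q₁ p₂ q₂ p₃ q₃ := by
  have hU0 : 0 ≤ U := hq₂.trans hU
  obtain ⟨V, hV⟩ : ∃ V, V = p₂ + q₂ - U := ⟨_, rfl⟩
  have hV0 : 0 ≤ V := by linarith
  have hr := div_mul_self_of_le (p₂ := p₂) hq₂ hU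
  rw [familyInvariant, ← hV] at h
  rw [← hV] at hc
  obtain ⟨c, hc1, hcK⟩ : ∃ c, |c| ≤ 1 ∧ p₁ * U * c = K - q₁ * V := by
    rcases (mul_nonneg hp₁ hU0).eq_or_lt with h0 | h0
    · rw [← h0] at hc ⊢
      exact ⟨0, by simp, by simpa using (abs_nonpos_iff.1 hc).symm⟩
    · exact ⟨(K - q₁ * V) / (p₁ * U), by rwa [abs_div, abs_of_pos h0, div_le_one h0],
        by rw [mul_div_cancel₀ _ h0.ne']⟩
  obtain ⟨e, he, rfl⟩ := exists_norm_eq_one_re_eq hc1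
  have hw : 0 ≤ U * V - p₂ * q₂ := by
    rw [hV]; nlinarith [mul_nonneg (sub_nonneg.2 hU) (sub_nonneg.2 hU')]
  obtain ⟨T, hT⟩ := IsAlgClosed.exists_pow_nat_eq
    (-2 * ((U * V - p₂ * q₂ : ℝ) : ℂ) * e) two_pos
  have hTn : ‖T‖ ^ 2 = 2 * (U * V - p₂ * q₂) := by
    rw [← norm_pow, hT]
    simp only [norm_mul, he, Complex.norm_real, Real.norm_of_nonneg hw]
    simp
  have hp₂ : 0 ≤ p₂ := hU0.trans hU'
  refine ⟨p₁, q₁, 0, U * e, V, T, -(p₁ + U * e), -(q₁ + V), -T, ?_, ⟨?_, ?_⟩, ⟨?_, ?_⟩,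
    by ring, by ring, by ring⟩
  · simp [IsSpin, abs_of_nonneg hp₁, abs_of_nonneg hq₁]
  · rw [hTn, norm_mul, he, Complex.norm_real, Complex.norm_real, Real.norm_of_nonneg hU0,
      Real.norm_of_nonneg hV0, hV]
    ring
  · have : (U * e * V + T ^ 2 / 2 : ℂ) = ((p₂ * q₂ : ℝ) : ℂ) * e := by
      rw [hT]; push_cast; ring
    rw [this, norm_mul, he, Complex.norm_real, Real.norm_of_nonneg (mul_nonneg hp₂ hq₂), mul_one]
  · rw [norm_neg, norm_neg, norm_neg, hTn, norm_add_real_mul_sq _ _ he, ← Complex.ofReal_add,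
      Complex.norm_real, Real.norm_eq_abs, sq_abs, ← hK, hV]
    rw [hV] at hcK
    linear_combination 2 * hcK
  · have : (-(p₁ + U * e) * -(q₁ + V) + (-T) ^ 2 / 2 : ℂ) =
        ((p₁ * (q₁ + V) : ℝ) : ℂ) + ((U * q₁ + p₂ * q₂ : ℝ) : ℂ) * e := by
      rw [neg_sq, hT]; push_cast; ring
    rw [this, ← sq_eq_sq₀ (norm_nonneg _) (mul_nonneg hp₃ hq₃), norm_add_real_mul_sq _ _ he, ← h,
      ← hcK]
    linear_combination (-2) * (q₁ + V) * p₁ * e.re * hr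

theorem continuousOn_familyInvariant {K : ℝ} (hq₂ : 0 ≤ q₂) :
    ContinuousOn (familyInvariant p₁ q₁ p₂ q₂ K) (Set.Icc q₂ p₂) := by
  unfold familyInvariant
  rcases hq₂.eq_or_lt with rfl | h
  · simp only [mul_zero, zero_div]
    fun_prop
  · have : ∀ U ∈ Set.Icc q₂ p₂, U ≠ 0 := fun U hU => (h.trans_le hU.1).ne'
    fun_prop (disch := assumption)

theorem affine_nonneg_of_mem_uIcc {m c a b U : ℝ} (ha : 0 ≤ c + m * a) (hb : 0 ≤ c + m * b)
    (hU : U ∈ Set.uIcc a b) : 0 ≤ c + m * U := by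
  rcases le_total 0 m with hm | hm <;> rcases Set.mem_uIcc.1 hU with ⟨h1, h2⟩ | ⟨h1, h2⟩ <;>
    nlinarith

theorem Closes.of_familyInvariant_le_of_le {K a b : ℝ} (hp₁ : 0 ≤ p₁) (hq₁ : 0 ≤ q₁)
    (hq₂ : 0 ≤ q₂) (hp₃ : 0 ≤ p₃) (hq₃ : 0 ≤ q₃)
    (hK : p₁ ^ 2 + q₁ ^ 2 + p₂ ^ 2 + q₂ ^ 2 + 2 * K = p₃ ^ 2 + q₃ ^ 2)
    (ha : a ∈ Set.Icc q₂ p₂) (hb : b ∈ Set.Icc q₂ p₂)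
    (hca : |K - q₁ * (p₂ + q₂ - a)| ≤ p₁ * a) (hcb : |K - q₁ * (p₂ + q₂ - b)| ≤ p₁ * b)
    (hfa : familyInvariant p₁ q₁ p₂ q₂ K a ≤ (p₃ * q₃) ^ 2)
    (hfb : (p₃ * q₃) ^ 2 ≤ familyInvariant p₁ q₁ p₂ q₂ K b) :
    Closes p₁ q₁ p₂ q₂ p₃ q₃ := by
  have hsub : Set.uIcc a b ⊆ Set.Icc q₂ p₂ := Set.ordConnected_Icc.uIcc_subset ha hb
  obtain ⟨U, hU, h⟩ := intermediate_value_uIcc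
    ((continuousOn_familyInvariant (p₁ := p₁) (q₁ := q₁) (K := K) hq₂).mono hsub)
    (Set.mem_uIcc.2 (Or.inl ⟨hfa, hfb⟩))
  refine Closes.of_familyInvariant_eq hp₁ hq₁ hq₂ hp₃ hq₃ (hsub hU).1 (hsub hU).2 hK ?_ h
  rw [abs_le] at *
  constructor
  · have := affine_nonneg_of_mem_uIcc (m := p₁ + q₁) (c := K - q₁ * (p₂ + q₂))
      (by linarith) (by linarith) hU
    linarith
  · have := affine_nonneg_of_mem_uIcc (m := p₁ - q₁) (c := q₁ * (p₂ + q₂) - K)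
      (by linarith) (by linarith) hU
    linarith

/-- The facet inequalities in the coordinates `p = x + y`, `q = x - y`. -/
structure PQFacets (p₁ q₁ p₂ q₂ p₃ q₃ : ℝ) : Prop where
  q₁_nonneg : 0 ≤ q₁
  q₂_nonneg : 0 ≤ q₂
  q₃_nonneg : 0 ≤ q₃
  q₁_le : q₁ ≤ p₁
  q₂_le : q₂ ≤ p₂
  q₃_le : q₃ ≤ p₃
  x₁_le : p₁ + q₁ ≤ p₂ + q₂ + (p₃ + q₃)
  x₂_le : p₂ + q₂ ≤ p₃ + q₃ + (p₁ + q₁)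
  x₃_le : p₃ + q₃ ≤ p₁ + q₁ + (p₂ + q₂)
  p₁_le : p₁ ≤ p₂ + p₃
  p₂_le : p₂ ≤ p₃ + p₁
  p₃_le : p₃ ≤ p₁ + p₂
  y₁₂_le : p₁ - q₁ ≤ p₂ - q₂ + (p₃ + q₃)
  y₁₃_le : p₁ - q₁ ≤ p₃ - q₃ + (p₂ + q₂)
  y₂₁_le : p₂ - q₂ ≤ p₁ - q₁ + (p₃ + q₃)
  y₂₃_le : p₂ - q₂ ≤ p₃ - q₃ + (p₁ + q₁)
  y₃₁_le : p₃ - q₃ ≤ p₁ - q₁ + (p₂ + q₂)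
  y₃₂_le : p₃ - q₃ ≤ p₂ - q₂ + (p₁ + q₁)
  q₁₂_le : q₁ ≤ q₂ + p₃
  q₁₃_le : q₁ ≤ q₃ + p₂
  q₂₁_le : q₂ ≤ q₁ + p₃
  q₂₃_le : q₂ ≤ q₃ + p₁
  q₃₁_le : q₃ ≤ q₁ + p₂
  q₃₂_le : q₃ ≤ q₂ + p₁

theorem PQFacets.rotate (h : PQFacets p₁ q₁ p₂ q₂ p₃ q₃) : PQFacets p₂ q₂ p₃ q₃ p₁ q₁ := by
  obtain ⟨⟩ := h
  constructor <;> linarith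

theorem PQFacets.swap (h : PQFacets p₁ q₁ p₂ q₂ p₃ q₃) : PQFacets p₂ q₂ p₁ q₁ p₃ q₃ := by
  obtain ⟨⟩ := h
  constructor <;> linarith

theorem familyInvariant_right {K : ℝ} (hq₂ : 0 ≤ q₂) (h : q₂ ≤ p₂)
    (hK : p₁ ^ 2 + q₁ ^ 2 + p₂ ^ 2 + q₂ ^ 2 + 2 * K = p₃ ^ 2 + q₃ ^ 2) :
    familyInvariant p₁ q₁ p₂ q₂ K p₂ =
      (p₃ * q₃) ^ 2 + ((q₁ + q₂) ^ 2 - q₃ ^ 2) * (p₃ ^ 2 - (q₁ + q₂) ^ 2) := by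
  have hr : p₂ * q₂ / p₂ = q₂ := by
    rcases eq_or_ne p₂ 0 with rfl | h0
    · simp [le_antisymm h hq₂]
    · field_simp
  rw [familyInvariant, hr]
  linear_combination (q₁ + q₂) ^ 2 * hK

theorem familyInvariant_left {K : ℝ} (hq₂ : 0 ≤ q₂)
    (hK : p₁ ^ 2 + q₁ ^ 2 + p₂ ^ 2 + q₂ ^ 2 + 2 * K = p₃ ^ 2 + q₃ ^ 2)
    (hc : |K - q₁ * (p₂ + q₂ - q₂)| ≤ p₁ * q₂) :
    familyInvariant p₁ q₁ p₂ q₂ K q₂ =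
      (p₃ * q₃) ^ 2 + ((q₁ + p₂) ^ 2 - q₃ ^ 2) * (p₃ ^ 2 - (q₁ + p₂) ^ 2) := by
  have hr : p₂ * q₂ / q₂ * (K - q₁ * (p₂ + q₂ - q₂)) = p₂ * (K - q₁ * (p₂ + q₂ - q₂)) := by
    rcases eq_or_ne q₂ 0 with rfl | h0
    · rw [mul_zero, abs_nonpos_iff] at hc
      rw [hc]; simp
    · field_simp
  rw [familyInvariant]
  linear_combination (q₁ + p₂) ^ 2 * hK + 2 * (q₁ + p₂) * hr

theorem familyInvariant_of_eq {K U s : ℝ} (hq₂ : 0 ≤ q₂) (hU : q₂ ≤ U) (hs : s ^ 2 = 1)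
    (h : K - q₁ * (p₂ + q₂ - U) = s * (p₁ * U)) :
    familyInvariant p₁ q₁ p₂ q₂ K U =
      (p₁ * (q₁ + (p₂ + q₂ - U)) + s * (U * q₁ + p₂ * q₂)) ^ 2 := by
  have hr := div_mul_self_of_le (p₂ := p₂) hq₂ hU
  rw [familyInvariant, h]
  linear_combination 2 * (q₁ + (p₂ + q₂ - U)) * s * p₁ * hr -
    (U * q₁ + p₂ * q₂) ^ 2 * hs

theorem exists_affine_eq_zero {m c a b : ℝ} (hab : a ≤ b) (ha : c + m * a ≤ 0)
    (hb : 0 ≤ c + m * b) : ∃ U ∈ Set.Icc a b, c + m * U = 0 :=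
  intermediate_value_Icc hab (by fun_prop) ⟨ha, hb⟩

theorem abs_sub_le_of_sq_le {K : ℝ}
    (hK : p₁ ^ 2 + q₁ ^ 2 + p₂ ^ 2 + q₂ ^ 2 + 2 * K = p₃ ^ 2 + q₃ ^ 2)
    (hP : (p₁ - p₂) ^ 2 + (q₁ + q₂) ^ 2 ≤ p₃ ^ 2 + q₃ ^ 2)
    (hP' : p₃ ^ 2 + q₃ ^ 2 ≤ (p₁ + p₂) ^ 2 + (q₁ + q₂) ^ 2) :
    |K - q₁ * (p₂ + q₂ - p₂)| ≤ p₁ * p₂ := by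
  rw [abs_le]; constructor <;> linarith

namespace PQFacets

theorem closes_of_ends (h : PQFacets p₁ q₁ p₂ q₂ p₃ q₃)
    (hP : (p₁ - p₂) ^ 2 + (q₁ + q₂) ^ 2 ≤ p₃ ^ 2 + q₃ ^ 2)
    (hP' : p₃ ^ 2 + q₃ ^ 2 ≤ (p₁ + p₂) ^ 2 + (q₁ + q₂) ^ 2)
    (hlo : ((q₁ + q₂) ^ 2 - q₃ ^ 2) * (p₃ ^ 2 - (q₁ + q₂) ^ 2) ≤ 0)
    (hQ : (p₁ - q₂) ^ 2 + (q₁ + p₂) ^ 2 ≤ p₃ ^ 2 + q₃ ^ 2)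
    (hQ' : p₃ ^ 2 + q₃ ^ 2 ≤ (p₁ + q₂) ^ 2 + (q₁ + p₂) ^ 2)
    (hhi : 0 ≤ ((q₁ + p₂) ^ 2 - q₃ ^ 2) * (p₃ ^ 2 - (q₁ + p₂) ^ 2)) :
    Closes p₁ q₁ p₂ q₂ p₃ q₃ := by
  obtain ⟨K, hK⟩ : ∃ K, p₁ ^ 2 + q₁ ^ 2 + p₂ ^ 2 + q₂ ^ 2 + 2 * K = p₃ ^ 2 + q₃ ^ 2 :=
    ⟨(p₃ ^ 2 + q₃ ^ 2 - (p₁ ^ 2 + q₁ ^ 2 + p₂ ^ 2 + q₂ ^ 2)) / 2, by ring⟩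
  have hcQ : |K - q₁ * (p₂ + q₂ - q₂)| ≤ p₁ * q₂ := by
    rw [abs_le]; constructor <;> linarith
  refine Closes.of_familyInvariant_le_of_le (h.q₁_nonneg.trans h.q₁_le) h.q₁_nonneg h.q₂_nonneg
    (h.q₃_nonneg.trans h.q₃_le) h.q₃_nonneg hK ⟨h.q₂_le, le_rfl⟩ ⟨le_rfl, h.q₂_le⟩
    (abs_sub_le_of_sq_le hK hP hP') hcQ ?_ ?_
  · rw [familyInvariant_right h.q₂_nonneg h.q₂_le hK]; linarith
  · rw [familyInvariant_left h.q₂_nonneg hK hcQ]; linarith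

theorem closes_of_add_sq_le (h : PQFacets p₁ q₁ p₂ q₂ p₃ q₃)
    (hP : (p₁ - p₂) ^ 2 + (q₁ + q₂) ^ 2 ≤ p₃ ^ 2 + q₃ ^ 2)
    (hP' : p₃ ^ 2 + q₃ ^ 2 ≤ (p₁ + p₂) ^ 2 + (q₁ + q₂) ^ 2)
    (hlo : ((q₁ + q₂) ^ 2 - q₃ ^ 2) * (p₃ ^ 2 - (q₁ + q₂) ^ 2) ≤ 0)
    (hL : (p₁ + q₂) ^ 2 + (q₁ + p₂) ^ 2 ≤ p₃ ^ 2 + q₃ ^ 2) :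
    Closes p₁ q₁ p₂ q₂ p₃ q₃ := by
  obtain ⟨K, hK⟩ : ∃ K, p₁ ^ 2 + q₁ ^ 2 + p₂ ^ 2 + q₂ ^ 2 + 2 * K = p₃ ^ 2 + q₃ ^ 2 :=
    ⟨(p₃ ^ 2 + q₃ ^ 2 - (p₁ ^ 2 + q₁ ^ 2 + p₂ ^ 2 + q₂ ^ 2)) / 2, by ring⟩
  have hp₁ := h.q₁_nonneg.trans h.q₁_le
  have hp₃ := h.q₃_nonneg.trans h.q₃_le
  obtain ⟨U, hU, hUL⟩ := exists_affine_eq_zero (m := p₁ - q₁) (c := q₁ * (p₂ + q₂) - K)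
    h.q₂_le (by linarith) (by linarith)
  have hU0 := h.q₂_nonneg.trans hU.1
  have heq : K - q₁ * (p₂ + q₂ - U) = 1 * (p₁ * U) := by linarith
  refine Closes.of_familyInvariant_le_of_le hp₁ h.q₁_nonneg h.q₂_nonneg
    hp₃ h.q₃_nonneg hK ⟨h.q₂_le, le_rfl⟩ hU (abs_sub_le_of_sq_le hK hP hP') ?_ ?_ ?_
  · rw [heq, one_mul, abs_of_nonneg (mul_nonneg hp₁ hU0)]
  · rw [familyInvariant_right h.q₂_nonneg h.q₂_le hK]; linarith
  · rw [familyInvariant_of_eq h.q₂_nonneg hU.1 (one_pow 2) heq]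
    have hx := pow_le_pow_left₀ (add_nonneg hp₃ h.q₃_nonneg) h.x₃_le 2
    exact pow_le_pow_left₀ (mul_nonneg hp₃ h.q₃_nonneg) (by linarith) 2

theorem exists_familyInvariant_eq_sub (h : PQFacets p₁ q₁ p₂ q₂ p₃ q₃) {K : ℝ}
    (hK : p₁ ^ 2 + q₁ ^ 2 + p₂ ^ 2 + q₂ ^ 2 + 2 * K = p₃ ^ 2 + q₃ ^ 2)
    (hP : (p₁ - p₂) ^ 2 + (q₁ + q₂) ^ 2 ≤ p₃ ^ 2 + q₃ ^ 2)
    (hM : p₃ ^ 2 + q₃ ^ 2 ≤ (p₁ - q₂) ^ 2 + (q₁ + p₂) ^ 2) :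
    ∃ U ∈ Set.Icc q₂ p₂, |K - q₁ * (p₂ + q₂ - U)| ≤ p₁ * U ∧
      ∃ g, familyInvariant p₁ q₁ p₂ q₂ K U = g ^ 2 ∧
        2 * g = p₃ ^ 2 + q₃ ^ 2 - (p₁ - q₁ - p₂ - q₂) ^ 2 := by
  have hp₁ := h.q₁_nonneg.trans h.q₁_le
  obtain ⟨U, hU, hUL⟩ := exists_affine_eq_zero (m := p₁ + q₁) (c := K - q₁ * (p₂ + q₂))
    h.q₂_le (by linarith) (by linarith)
  have hU0 := h.q₂_nonneg.trans hU.1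
  have heq : K - q₁ * (p₂ + q₂ - U) = -1 * (p₁ * U) := by linarith
  refine ⟨U, hU, ?_, _, familyInvariant_of_eq h.q₂_nonneg hU.1 (by norm_num) heq, ?_⟩
  · rw [heq, neg_one_mul, abs_neg, abs_of_nonneg (mul_nonneg hp₁ hU0)]
  · rw [← hK]
    linear_combination (-2) * heq

theorem closes_of_le_sub_sq_of_le (h : PQFacets p₁ q₁ p₂ q₂ p₃ q₃)
    (hP : (p₁ - p₂) ^ 2 + (q₁ + q₂) ^ 2 ≤ p₃ ^ 2 + q₃ ^ 2)
    (hP' : p₃ ^ 2 + q₃ ^ 2 ≤ (p₁ + p₂) ^ 2 + (q₁ + q₂) ^ 2)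
    (hlo : ((q₁ + q₂) ^ 2 - q₃ ^ 2) * (p₃ ^ 2 - (q₁ + q₂) ^ 2) ≤ 0)
    (hM : p₃ ^ 2 + q₃ ^ 2 ≤ (p₁ - q₂) ^ 2 + (q₁ + p₂) ^ 2)
    (hy : |p₁ - q₁ - p₂ - q₂| ≤ p₃ - q₃) :
    Closes p₁ q₁ p₂ q₂ p₃ q₃ := by
  obtain ⟨K, hK⟩ : ∃ K, p₁ ^ 2 + q₁ ^ 2 + p₂ ^ 2 + q₂ ^ 2 + 2 * K = p₃ ^ 2 + q₃ ^ 2 :=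
    ⟨(p₃ ^ 2 + q₃ ^ 2 - (p₁ ^ 2 + q₁ ^ 2 + p₂ ^ 2 + q₂ ^ 2)) / 2, by ring⟩
  have hp₃ := h.q₃_nonneg.trans h.q₃_le
  obtain ⟨U, hU, hUM, g, hg, hg'⟩ := h.exists_familyInvariant_eq_sub hK hP hM
  refine Closes.of_familyInvariant_le_of_le (h.q₁_nonneg.trans h.q₁_le) h.q₁_nonneg h.q₂_nonneg
    hp₃ h.q₃_nonneg hK ⟨h.q₂_le, le_rfl⟩ hU (abs_sub_le_of_sq_le hK hP hP') hUM ?_ ?_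
  · rw [familyInvariant_right h.q₂_nonneg h.q₂_le hK]; linarith
  · rw [hg]
    have := sq_le_sq' (abs_le.1 hy).1 (abs_le.1 hy).2
    exact pow_le_pow_left₀ (mul_nonneg hp₃ h.q₃_nonneg) (by linarith) 2

theorem closes_of_le_sub_sq_of_ge (h : PQFacets p₁ q₁ p₂ q₂ p₃ q₃)
    (hP : (p₁ - p₂) ^ 2 + (q₁ + q₂) ^ 2 ≤ p₃ ^ 2 + q₃ ^ 2)
    (hP' : p₃ ^ 2 + q₃ ^ 2 ≤ (p₁ + p₂) ^ 2 + (q₁ + q₂) ^ 2)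
    (hhi : 0 ≤ ((q₁ + q₂) ^ 2 - q₃ ^ 2) * (p₃ ^ 2 - (q₁ + q₂) ^ 2))
    (hM : p₃ ^ 2 + q₃ ^ 2 ≤ (p₁ - q₂) ^ 2 + (q₁ + p₂) ^ 2)
    (hy : p₃ - q₃ ≤ p₂ + q₂ - (p₁ - q₁)) (hx : p₂ + q₂ - (p₁ - q₁) ≤ p₃ + q₃) :
    Closes p₁ q₁ p₂ q₂ p₃ q₃ := by
  obtain ⟨K, hK⟩ : ∃ K, p₁ ^ 2 + q₁ ^ 2 + p₂ ^ 2 + q₂ ^ 2 + 2 * K = p₃ ^ 2 + q₃ ^ 2 :=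
    ⟨(p₃ ^ 2 + q₃ ^ 2 - (p₁ ^ 2 + q₁ ^ 2 + p₂ ^ 2 + q₂ ^ 2)) / 2, by ring⟩
  have hp₃ := h.q₃_nonneg.trans h.q₃_le
  obtain ⟨U, hU, hUM, g, hg, hg'⟩ := h.exists_familyInvariant_eq_sub hK hP hM
  refine Closes.of_familyInvariant_le_of_le (h.q₁_nonneg.trans h.q₁_le) h.q₁_nonneg h.q₂_nonneg
    hp₃ h.q₃_nonneg hK hU ⟨h.q₂_le, le_rfl⟩ hUM (abs_sub_le_of_sq_le hK hP hP') ?_ ?_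
  · rw [hg]
    have h1 := pow_le_pow_left₀ (sub_nonneg.2 h.q₃_le) hy 2
    have h2 := pow_le_pow_left₀ ((sub_nonneg.2 h.q₃_le).trans hy) hx 2
    exact sq_le_sq' (by linarith) (by linarith)
  · rw [familyInvariant_right h.q₂_nonneg h.q₂_le hK]; linarith

end PQFacets

theorem sq_add_sq_le_of_add_le {a b c d : ℝ} (ha : 0 ≤ a) (hb : 0 ≤ b) (hac : a ≤ c) (hbc : b ≤ c)
    (h : a + b ≤ c + d) : a ^ 2 + b ^ 2 ≤ c ^ 2 + d ^ 2 := by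
  rcases le_total d a with h1 | h1 <;> rcases le_total d b with h2 | h2 <;> nlinarith

theorem sub_mul_sub_nonpos {v p q : ℝ} (hv : 0 ≤ v) (hvq : v ≤ q) (hqp : q ≤ p) :
    (v ^ 2 - q ^ 2) * (p ^ 2 - v ^ 2) ≤ 0 := by
  have h1 := pow_le_pow_left₀ hv hvq 2
  have h2 := pow_le_pow_left₀ hv (hvq.trans hqp) 2
  exact mul_nonpos_of_nonpos_of_nonneg (by linarith) (by linarith)

theorem sub_mul_sub_nonneg {v p q : ℝ} (hq : 0 ≤ q) (hqv : q ≤ v) (hvp : v ≤ p) :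
    0 ≤ (v ^ 2 - q ^ 2) * (p ^ 2 - v ^ 2) := by
  have h1 := pow_le_pow_left₀ hq hqv 2
  have h2 := pow_le_pow_left₀ (hq.trans hqv) hvp 2
  exact mul_nonneg (by linarith) (by linarith)

namespace PQFacets

theorem closes_of_add_lt (h : PQFacets p₁ q₁ p₂ q₂ p₃ q₃) (hq : q₁ + q₂ < q₃) (hp : p₂ ≤ p₁) :
    Closes p₁ q₁ p₂ q₂ p₃ q₃ := by
  have h312 := h.rotate.rotate
  have h321 := h.swap.rotate.rotate
  have hh := h
  obtain ⟨_, _, _, _, _, _, _, _, _, _, _, _, _, _, _, _, _, _, _, _, _, _, _, _⟩ := hh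
  have hP : (p₁ - p₂) ^ 2 + (q₁ + q₂) ^ 2 ≤ p₃ ^ 2 + q₃ ^ 2 :=
    add_le_add (pow_le_pow_left₀ (by linarith) (by linarith) 2)
      (pow_le_pow_left₀ (by linarith) hq.le 2)
  have hP' : p₃ ^ 2 + q₃ ^ 2 ≤ (p₁ + p₂) ^ 2 + (q₁ + q₂) ^ 2 :=
    sq_add_sq_le_of_add_le (by linarith) (by linarith) (by linarith) (by linarith) (by linarith)
  have hlo := sub_mul_sub_nonpos (v := q₁ + q₂) (q := q₃) (p := p₃) (by linarith) hq.le h.q₃_le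
  have hP312' : p₂ ^ 2 + q₂ ^ 2 ≤ (p₃ + p₁) ^ 2 + (q₃ + q₁) ^ 2 :=
    add_le_add (pow_le_pow_left₀ (by linarith) (by linarith) 2)
      (pow_le_pow_left₀ (by linarith) (by linarith) 2)
  have hM312 : p₂ ^ 2 + q₂ ^ 2 ≤ (p₃ - q₁) ^ 2 + (q₃ + p₁) ^ 2 := by
    rw [add_comm ((p₃ - q₁) ^ 2)]
    exact sq_add_sq_le_of_add_le (by linarith) (by linarith) (by linarith) (by linarith)
      (by linarith)
  rcases le_or_gt (p₁ - q₂) q₃ with hI | hII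
  · rcases lt_or_ge p₃ (p₂ - q₁) with ha | ha
    · refine (h312.closes_of_le_sub_sq_of_ge ?_ hP312'
        (sub_mul_sub_nonneg (by linarith) (by linarith) (by linarith)) hM312
        (by linarith) (by linarith)).rotate
      rw [add_comm ((p₃ - p₁) ^ 2), sub_sq_comm p₃ p₁]
      exact add_le_add (pow_le_pow_left₀ (by linarith) (by linarith) 2)
        (pow_le_pow_left₀ (by linarith) (by linarith) 2)
    rcases le_or_gt p₃ (q₁ + p₂) with hb | hc
    · exact (Closes.of_triangles (by linarith) (by linarith) (by linarith) (by linarith)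
        (by linarith) (by linarith) (by linarith) (by linarith) (by linarith) (by linarith)
        (by linarith) (by linarith) : Closes q₁ p₁ p₂ q₂ p₃ q₃).comm_fst
    · rcases le_or_gt ((p₁ + q₂) ^ 2 + (q₁ + p₂) ^ 2) (p₃ ^ 2 + q₃ ^ 2) with hL | hL
      · exact h.closes_of_add_sq_le hP hP' hlo hL
      · refine h.closes_of_ends hP hP' hlo ?_ hL.le
          (sub_mul_sub_nonneg (by linarith) (by linarith) hc.le)
        rw [add_comm ((p₁ - q₂) ^ 2)]
        exact add_le_add (pow_le_pow_left₀ (by linarith) (by linarith) 2)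
          (pow_le_pow_left₀ (by linarith) (by linarith) 2)
  · rcases lt_or_ge (p₃ - q₃) (p₂ + q₂ - (p₁ - q₁)) with ha | hb
    · rcases le_or_gt (p₂ + q₂ - (p₃ - q₃)) (p₁ + q₁) with hx | hx
      · refine (h321.closes_of_le_sub_sq_of_ge ?_
          (add_le_add (pow_le_pow_left₀ (by linarith) (by linarith) 2)
            (pow_le_pow_left₀ (by linarith) (by linarith) 2))
          (sub_mul_sub_nonneg (by linarith) (by linarith) (by linarith)) ?_
          (by linarith) (by linarith)).swap.rotate.rotate
        · rcases le_total p₃ p₂ with h32 | h32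
          · rw [sub_sq_comm p₃ p₂]
            exact sq_add_sq_le_of_add_le (by linarith) (by linarith) (by linarith) (by linarith)
              (by linarith)
          · rw [add_comm ((p₃ - p₂) ^ 2)]
            exact add_le_add (pow_le_pow_left₀ (by linarith) (by linarith) 2)
              (pow_le_pow_left₀ (by linarith) (by linarith) 2)
        · rw [add_comm ((p₃ - q₂) ^ 2)]
          exact add_le_add (pow_le_pow_left₀ (by linarith) (by linarith) 2)
            (pow_le_pow_left₀ (by linarith) (by linarith) 2)
      · refine (h312.closes_of_le_sub_sq_of_ge ?_ hP312'
          (sub_mul_sub_nonneg (by linarith) (by linarith) (by linarith)) hM312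
          (by linarith) (by linarith)).rotate
        rw [sub_sq_comm p₃ p₁]
        exact sq_add_sq_le_of_add_le (by linarith) (by linarith) (by linarith) (by linarith)
          (by linarith)
    · rcases le_or_gt ((p₁ + q₂) ^ 2 + (q₁ + p₂) ^ 2) (p₃ ^ 2 + q₃ ^ 2) with hL | hL
      · exact h.closes_of_add_sq_le hP hP' hlo hL
      rcases le_or_gt (p₃ ^ 2 + q₃ ^ 2) ((p₁ - q₂) ^ 2 + (q₁ + p₂) ^ 2) with hM | hM
      · exact h.closes_of_le_sub_sq_of_le hP hP' hlo hM
          (abs_le.2 ⟨by linarith, by linarith⟩)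
      · have hq₃ : q₃ ^ 2 ≤ (p₁ - q₂) ^ 2 := pow_le_pow_left₀ (by linarith) hII.le 2
        have hp₃ : q₁ + p₂ ≤ p₃ := abs_le_of_sq_le_sq' (by linarith) (by linarith) |>.2
        exact h.closes_of_ends hP hP' hlo hM.le hL.le
          (sub_mul_sub_nonneg (by linarith) (by linarith) hp₃)

theorem closes_of_add_lt' (h : PQFacets p₁ q₁ p₂ q₂ p₃ q₃) (hq : q₁ + q₂ < q₃) :
    Closes p₁ q₁ p₂ q₂ p₃ q₃ := by
  rcases le_total p₂ p₁ with hp | hp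
  · exact h.closes_of_add_lt hq hp
  · exact (h.swap.closes_of_add_lt (by linarith) hp).swap

theorem closes (h : PQFacets p₁ q₁ p₂ q₂ p₃ q₃) : Closes p₁ q₁ p₂ q₂ p₃ q₃ := by
  rcases lt_or_ge (q₁ + q₂) q₃ with h3 | h3
  · exact h.closes_of_add_lt' h3
  rcases lt_or_ge (q₂ + q₃) q₁ with h1 | h1
  · exact (h.rotate.closes_of_add_lt' h1).rotate.rotate
  rcases lt_or_ge (q₃ + q₁) q₂ with h2 | h2
  · exact (h.rotate.rotate.closes_of_add_lt' h2).rotate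
  exact Closes.of_triangles (h.q₁_nonneg.trans h.q₁_le) h.q₁_nonneg
    (h.q₂_nonneg.trans h.q₂_le) h.q₂_nonneg (h.q₃_nonneg.trans h.q₃_le) h.q₃_nonneg
    h.p₁_le h.p₂_le h.p₃_le h1 h2 h3

end PQFacets

end Closing

theorem exists_perm_apply_eq {n : ℕ} {f g : Fin n → ℝ}
    (h : Finset.univ.val.map f = Finset.univ.val.map g) :
    ∃ τ : Equiv.Perm (Fin n), ∀ j, f (τ j) = g j := by
  have key : ∀ r, Nonempty ({a // g a = r} ≃ {a // f a = r}) := by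
    intro r
    rw [← Fintype.card_eq, Fintype.card_subtype, Fintype.card_subtype]
    have := congrArg (Multiset.count r) h
    rw [Multiset.count_map, Multiset.count_map] at this
    simp only [eq_comm (b := r), Finset.card, Finset.filter_val]
    simpa [eq_comm] using this.symm
  exact ⟨Equiv.ofFiberEquiv fun r => (key r).some, Equiv.ofFiberEquiv_map _⟩

/-- The skew-symmetric matrix pairing the plane of the first two coordinates with the space of
the last three through the real and imaginary parts of a vector of `ℂ³`. -/
def skewOfVec (z₀ z₁ z₂ : ℂ) : Matrix (Fin 5) (Fin 5) ℝ :=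
  !![0, 0, z₀.re, z₁.re, z₂.re;
     0, 0, z₀.im, z₁.im, z₂.im;
     -z₀.re, -z₀.im, 0, 0, 0;
     -z₁.re, -z₁.im, 0, 0, 0;
     -z₂.re, -z₂.im, 0, 0, 0]

theorem skewOfVec_transpose (z₀ z₁ z₂ : ℂ) :
    (skewOfVec z₀ z₁ z₂)ᵀ = -skewOfVec z₀ z₁ z₂ := by
  ext i j
  fin_cases i <;> fin_cases j <;> simp [skewOfVec]

theorem skewOfVec_add (z₀ z₁ z₂ w₀ w₁ w₂ : ℂ) :
    skewOfVec z₀ z₁ z₂ + skewOfVec w₀ w₁ w₂ = skewOfVec (z₀ + w₀) (z₁ + w₁) (z₂ + w₂) := by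
  ext i j
  fin_cases i <;> fin_cases j <;> simp [skewOfVec, add_comm]

theorem isHermitian_I_smul_map {n : Type*} {S : Matrix n n ℝ} (hS : Sᵀ = -S) :
    (Complex.I • S.map (Complex.ofReal ·)).IsHermitian := by
  ext i j
  have : S j i = -S i j := congrFun (congrFun hS i) j
  simp [this]

theorem det_skew_block {R : Type*} [CommRing R] (X a b c d e f : R) :
    Matrix.det !![X, 0, -a, -b, -c; 0, X, -d, -e, -f; a, d, X, 0, 0; b, e, 0, X, 0;
      c, f, 0, 0, X] =
    X ^ 5 + (a ^ 2 + b ^ 2 + c ^ 2 + d ^ 2 + e ^ 2 + f ^ 2) * X ^ 3 +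
      ((a * e - b * d) ^ 2 + (a * f - c * d) ^ 2 + (b * f - c * e) ^ 2) * X := by
  simp [Matrix.det_succ_row_zero, Fin.sum_univ_succ, Fin.succAbove]
  ring

theorem charpoly_I_smul_skewOfVec {x y : ℝ} {z₀ z₁ z₂ : ℂ}
    (h1 : ‖z₀‖ ^ 2 + ‖z₁‖ ^ 2 + ‖z₂‖ ^ 2 = x ^ 2 + y ^ 2)
    (h2 : ‖z₀ ^ 2 + z₁ ^ 2 + z₂ ^ 2‖ ^ 2 = (x ^ 2 - y ^ 2) ^ 2) :
    (Complex.I • (skewOfVec z₀ z₁ z₂).map (Complex.ofReal ·)).charpoly =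
      ((Finset.univ.val.map fun j => ((![x, y, 0, -y, -x] j : ℝ) : ℂ)).map
        fun r => Polynomial.X - Polynomial.C r).prod := by
  refine Polynomial.funext fun t => ?_
  have h3 : (Matrix.scalar (Fin 5) t - Complex.I • (skewOfVec z₀ z₁ z₂).map (Complex.ofReal ·)) =
      !![t, 0, -(Complex.I * z₀.re), -(Complex.I * z₁.re), -(Complex.I * z₂.re);
        0, t, -(Complex.I * z₀.im), -(Complex.I * z₁.im), -(Complex.I * z₂.im);
        Complex.I * z₀.re, Complex.I * z₀.im, t, 0, 0;
        Complex.I * z₁.re, Complex.I * z₁.im, 0, t, 0;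
        Complex.I * z₂.re, Complex.I * z₂.im, 0, 0, t] := by
    ext i j
    fin_cases i <;> fin_cases j <;> simp [skewOfVec]
  rw [Matrix.eval_charpoly, h3, det_skew_block]
  simp only [Complex.sq_norm, Complex.normSq_apply] at h1 h2
  simp [pow_two] at h2
  have h1' := congrArg (Complex.ofReal) h1
  have h4 : (z₀.re * z₁.im - z₁.re * z₀.im) ^ 2 + (z₀.re * z₂.im - z₂.re * z₀.im) ^ 2 +
      (z₁.re * z₂.im - z₂.re * z₁.im) ^ 2 = x ^ 2 * y ^ 2 := by
    linear_combination (z₀.re * z₀.re + z₀.im * z₀.im + (z₁.re * z₁.re + z₁.im * z₁.im) +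
      (z₂.re * z₂.re + z₂.im * z₂.im) + x ^ 2 + y ^ 2) / 4 * h1 - h2 / 4
  have h4' := congrArg (Complex.ofReal) h4
  push_cast at h1' h4'
  simp [Fin.univ_succ, Polynomial.eval_mul]
  linear_combination (norm := skip) t * h4' - t ^ 3 * h1'
  ring_nf
  simp
  ring

theorem exists_eigenvalues_skewOfVec {x y : ℝ} {z₀ z₁ z₂ : ℂ}
    (h1 : ‖z₀‖ ^ 2 + ‖z₁‖ ^ 2 + ‖z₂‖ ^ 2 = x ^ 2 + y ^ 2)
    (h2 : ‖z₀ ^ 2 + z₁ ^ 2 + z₂ ^ 2‖ ^ 2 = (x ^ 2 - y ^ 2) ^ 2) :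
    ∃ hh : (Complex.I • (skewOfVec z₀ z₁ z₂).map (Complex.ofReal ·)).IsHermitian,
      ∃ τ : Equiv.Perm (Fin 5), ∀ j, hh.eigenvalues (τ j) = ![x, y, 0, -y, -x] j := by
  refine ⟨isHermitian_I_smul_map (skewOfVec_transpose z₀ z₁ z₂), exists_perm_apply_eq ?_⟩
  have h := (isHermitian_I_smul_map (skewOfVec_transpose z₀ z₁ z₂)).roots_charpoly_eq_eigenvalues
  rw [charpoly_I_smul_skewOfVec h1 h2, Polynomial.roots_multiset_prod_X_sub_C] at h
  refine Multiset.map_injective Complex.ofReal_injective ?_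
  rw [Multiset.map_map, Multiset.map_map]
  exact h.symm

/-- The skew-symmetric matrix of the vector `((U + V) / 2, i (U - V) / 2, T / √2)`. -/
noncomputable def skewOfSpin (U V T : ℂ) : Matrix (Fin 5) (Fin 5) ℝ :=
  skewOfVec ((U + V) / 2) (Complex.I * ((U - V) / 2)) (T / (√2 : ℝ))

theorem IsSpin.exists_eigenvalues {x y : ℝ} {U V T : ℂ} (h : IsSpin (x + y) (x - y) U V T) :
    ∃ hh : (Complex.I • (skewOfSpin U V T).map (Complex.ofReal ·)).IsHermitian,
      ∃ τ : Equiv.Perm (Fin 5), ∀ j, hh.eigenvalues (τ j) = ![x, y, 0, -y, -x] j := by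
  obtain ⟨h1, h2⟩ := h
  refine exists_eigenvalues_skewOfVec ?_ ?_
  · have h3 : ‖U + V‖ ^ 2 + ‖U - V‖ ^ 2 = 2 * (‖U‖ ^ 2 + ‖V‖ ^ 2) := by
      simpa [pow_two] using parallelogram_law_with_norm ℝ U V
    simp only [norm_div, norm_mul, Complex.norm_I, Complex.norm_real, one_mul, div_pow,
      Real.norm_eq_abs, sq_abs, Real.sq_sqrt zero_le_two, Complex.norm_ofNat]
    linarith
  · have h3 : ((√2 : ℝ) : ℂ) ^ 2 = 2 := by
      rw [← Complex.ofReal_pow, Real.sq_sqrt zero_le_two]; simp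
    have h4 : ((U + V) / 2) ^ 2 + (Complex.I * ((U - V) / 2)) ^ 2 + (T / (√2 : ℝ)) ^ 2 =
        U * V + T ^ 2 / 2 := by
      rw [div_pow T, h3, mul_pow, Complex.I_sq]
      ring
    rw [h4, h2]
    ring

theorem Closes.exists_matrices {x y : Fin 3 → ℝ}
    (h : Closes (x 0 + y 0) (x 0 - y 0) (x 1 + y 1) (x 1 - y 1) (x 2 + y 2) (x 2 - y 2)) :
    ∃ S : Fin 3 → Matrix (Fin 5) (Fin 5) ℝ,
      (∀ i, (S i)ᵀ = -(S i)) ∧ (∑ i, S i) = 0 ∧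
      ∀ i, ∃ hh : (Complex.I • (S i).map (Complex.ofReal ·)).IsHermitian,
        ∃ τ : Equiv.Perm (Fin 5),
          ∀ j, hh.eigenvalues (τ j) = ![x i, y i, 0, -y i, -x i] j := by
  obtain ⟨U₁, V₁, T₁, U₂, V₂, T₂, U₃, V₃, T₃, h1, h2, h3, hU, hV, hT⟩ := h
  refine ⟨![skewOfSpin U₁ V₁ T₁, skewOfSpin U₂ V₂ T₂, skewOfSpin U₃ V₃ T₃], ?_, ?_, ?_⟩
  · intro i
    fin_cases i <;> exact skewOfVec_transpose _ _ _
  · simp only [Fin.sum_univ_three, Matrix.cons_val, skewOfSpin, skewOfVec_add]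
    rw [show (U₁ + V₁) / 2 + (U₂ + V₂) / 2 + (U₃ + V₃) / 2 = 0 by
        linear_combination hU / 2 + hV / 2,
      show Complex.I * ((U₁ - V₁) / 2) + Complex.I * ((U₂ - V₂) / 2) +
        Complex.I * ((U₃ - V₃) / 2) = 0 by linear_combination Complex.I * (hU - hV) / 2,
      ← add_div, ← add_div, hT, zero_div]
    ext i j
    fin_cases i <;> fin_cases j <;> simp [skewOfVec]
  · intro i
    fin_cases i
    · exact h1.exists_eigenvalues
    · exact h2.exists_eigenvalues
    · exact h3.exists_eigenvalues

theorem B2Facets.pqFacets {x y : Fin 3 → ℝ} (h : B2Facets x y) :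
    PQFacets (x 0 + y 0) (x 0 - y 0) (x 1 + y 1) (x 1 - y 1) (x 2 + y 2) (x 2 - y 2) := by
  obtain ⟨h1, h2, h3, h4, h5, h6⟩ := h
  simp [Fin.forall_fin_succ] at h1 h2 h3 h4 h5 h6
  obtain ⟨⟨_, _⟩, ⟨_, _⟩, _, _⟩ := h3
  obtain ⟨⟨_, _⟩, ⟨_, _⟩, _, _⟩ := h4
  obtain ⟨⟨_, _⟩, ⟨_, _⟩, _, _⟩ := h5
  obtain ⟨⟨_, _⟩, ⟨_, _⟩, _, _⟩ := h6
  obtain ⟨_, _, _⟩ := h1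
  obtain ⟨_, _, _⟩ := h2
  constructor <;> linarith

/-- The `Δ`-side length cone for `B₂ = C₂` is the set of linear combinations
with nonnegative coefficients of the twelve listed generators. -/
theorem b2_cone_generators :
    B2SideLengthCone =
      { h | ∃ c : Fin 12 → ℝ, (∀ k, 0 ≤ c k) ∧ h = ∑ k, c k • B2Generators k } := by
  ext h
  constructor
  · exact fun H => (b2Facets_of_mem_cone H).mem_cone
  · rintro ⟨c, hc, rfl⟩
    have H := B2Facets.of_cone hc
    exact ⟨fun i => ⟨H.le i, H.nonneg i⟩, H.pqFacets.closes.exists_matrices⟩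
end
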